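/- Let (V, ω) be a simple VOA of strong CFT type. Then Aut V = Aut⁻V · Aut⁰V · Aut⁺V; more precisely, for every f ∈ Aut V there exist unique g ∈ Aut⁻V, h ∈ Aut⁰V, and k ∈ Aut⁺V such that f = g h k. In particular, if J_1(V) = 0, then Aut V ≅ Aut⁺V ⋊ Aut⁰V. -/

import Mathlib

/-!
Common framework: vertex algebras, ℤ-graded (conformal) vertex algebras,
conformal vectors, automorphism groups, following Moriwaki,
"On classification of conformal vectors in vertex operator algebra and
the vertex algebra automorphism group".
-/

noncomputable section

open scoped BigOperators

/-- The generalized binomial coefficient `binom(m, i)` for `m : ℤ`, valued in a field `K`. -/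
def zBinom (K : Type*) [Field K] (m : ℤ) (i : ℕ) : K :=
  (∏ j ∈ Finset.range i, ((m : K) - (j : K))) / (Nat.factorial i : K)

/-- A vertex algebra over a field `K`: a `K`-vector space `V` equipped with bilinear
`n`-th products `a(n)b` (`n : ℤ`) and a vacuum vector `𝟙`, subject to the truncation
condition, the vacuum and creation axioms, and the Borcherds identity. -/
structure VA (K V : Type*) [Field K] [AddCommGroup V] [Module K V] where
  /-- the `n`-th product `a(n)b`, bilinear in `a` and `b` -/
  ncoef : ℤ → V →ₗ[K] V →ₗ[K] V
  /-- the vacuum vector `𝟙` -/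
  vac : V
  /-- truncation: `a(n)b = 0` for `n` sufficiently large -/
  trunc : ∀ a b : V, ∃ N : ℤ, ∀ n : ℤ, N ≤ n → ncoef n a b = 0
  /-- the vacuum axiom `Y(𝟙, z) = id`, i.e. `𝟙(n)a = δ_{n,-1} a` -/
  vac_ncoef : ∀ (n : ℤ) (a : V), ncoef n vac a = if n = -1 then a else 0
  /-- creation: `a(-1)𝟙 = a` -/
  ncoef_vac : ∀ a : V, ncoef (-1) a vac = a
  /-- creation: `a(n)𝟙 = 0` for `n ≥ 0` -/
  ncoef_vac_zero : ∀ n : ℤ, 0 ≤ n → ∀ a : V, ncoef n a vac = 0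
  /-- the Borcherds identity -/
  borcherds : ∀ (a b c : V) (p q m : ℤ),
    (∑ᶠ i : ℕ, zBinom K m i •
        ncoef (m + q - (i : ℤ)) (ncoef (p + (i : ℤ)) a b) c)
      = ∑ᶠ i : ℕ, ((-1 : K) ^ i * zBinom K p i) •
          (ncoef (m + p - (i : ℤ)) a (ncoef (q + (i : ℤ)) b c)
            - ((p.negOnePow : ℤ) : K) •
                ncoef (p + q - (i : ℤ)) b (ncoef (m + (i : ℤ)) a c))

namespace VA

variable {K V : Type*} [Field K] [AddCommGroup V] [Module K V]

/-- The translation operator `T a = a(-2)𝟙`. -/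
def T (A : VA K V) : V →ₗ[K] V := (A.ncoef (-2)).flip A.vac

/-- The eigenspace `V_n^a = {v ∈ V | a(1)v = n v}` of `a(1)`. -/
def eig (A : VA K V) (a : V) (n : ℤ) : Submodule K V :=
  LinearMap.ker (A.ncoef 1 a - (n : K) • (LinearMap.id : V →ₗ[K] V))

/-- `a` is a conformal vector: `a(1)a = 2a`, `a(3)a ∈ K𝟙`, `a(2)a = 0`, `a(n)a = 0`
for `n ≥ 4`, `a(0) = T`, and `a(1)` is semisimple with integer eigenvalues
(`V = ⊕_{n ∈ ℤ} V_n^a`). -/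
def IsConformal (A : VA K V) (a : V) : Prop :=
  A.ncoef 1 a a = (2 : K) • a ∧
  (∃ c : K, A.ncoef 3 a a = c • A.vac) ∧
  A.ncoef 2 a a = 0 ∧
  (∀ n : ℤ, 4 ≤ n → A.ncoef n a a = 0) ∧
  A.ncoef 0 a = A.T ∧
  DirectSum.IsInternal (A.eig a)

/-- `a` is a conformal vector of CFT type: `(V, a)` is a VOA of CFT type, i.e.
`V = ⊕_{n ∈ ℕ} V_n^a` with finite-dimensional pieces and `V_0^a = K𝟙`. -/
def IsConformalCFT (A : VA K V) (a : V) : Prop :=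
  A.IsConformal a ∧
  (∀ n : ℤ, n < 0 → A.eig a n = ⊥) ∧
  (∀ n : ℤ, FiniteDimensional K (A.eig a n)) ∧
  A.eig a 0 = Submodule.span K {A.vac}

/-- `a` is a conformal vector of strong CFT type: of CFT type and `a(2)V_1^a = 0`
(i.e. `L^a(1) V_1^a = 0`). -/
def IsConformalSCFT (A : VA K V) (a : V) : Prop :=
  A.IsConformalCFT a ∧ ∀ v ∈ A.eig a 1, A.ncoef 2 a v = 0

/-- A vertex algebra homomorphism: a linear map preserving all products and the vacuum. -/
structure IsVAHom (A : VA K V) (f : V → V) : Prop where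
  map_add : ∀ a b : V, f (a + b) = f a + f b
  map_smul : ∀ (c : K) (a : V), f (c • a) = c • f a
  map_ncoef : ∀ (n : ℤ) (a b : V), f (A.ncoef n a b) = A.ncoef n (f a) (f b)
  map_vac : f A.vac = A.vac

/-- A vertex algebra automorphism: a bijective vertex algebra homomorphism. -/
def IsVAAut (A : VA K V) (f : V → V) : Prop :=
  A.IsVAHom f ∧ Function.Bijective f

/-- A (two-sided) ideal of a vertex algebra. -/
def IsIdeal (A : VA K V) (I : Submodule K V) : Prop :=
  ∀ (n : ℤ) (a : V), ∀ b ∈ I, A.ncoef n a b ∈ I ∧ A.ncoef n b a ∈ I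

/-- A vertex algebra is simple if it has no ideals other than `0` and itself. -/
def IsSimple (A : VA K V) : Prop :=
  ∀ I : Submodule K V, A.IsIdeal I → I = ⊥ ∨ I = ⊤

end VA

/-- The exponential `exp f = Σ_{n≥0} f^n / n!` of an endomorphism, as a function
(meaningful for locally nilpotent `f`). -/
def expOp {K V : Type*} [Field K] [AddCommGroup V] [Module K V]
    (f : V →ₗ[K] V) (v : V) : V :=
  ∑ᶠ n : ℕ, (Nat.factorial n : K)⁻¹ • (f ^ n) v

/-- A ℤ-grading on a vertex algebra, making it a ℤ-graded vertex algebra: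
`V = ⊕_{n ∈ ℤ} V_n`, `V_n(k)V_m ⊆ V_{n+m-k-1}` and `𝟙 ∈ V_0`. -/
structure GradedVA {K V : Type*} [Field K] [AddCommGroup V] [Module K V] (A : VA K V) where
  /-- the grading subspaces `V_n` -/
  gr : ℤ → Submodule K V
  /-- `V = ⊕_{n ∈ ℤ} V_n` -/
  decomp : DirectSum.Decomposition gr
  /-- `𝟙 ∈ V_0` -/
  vac_mem : A.vac ∈ gr 0
  /-- `V_n(k)V_m ⊆ V_{n+m-k-1}` -/
  ncoef_mem : ∀ (n m k : ℤ), ∀ a ∈ gr n, ∀ b ∈ gr m, A.ncoef k a b ∈ gr (n + m - k - 1)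

namespace GradedVA

variable {K V : Type*} [Field K] [AddCommGroup V] [Module K V] {A : VA K V}

/-- The canonical projection `pr_n : V → V_n`. -/
def pr (G : GradedVA A) (n : ℤ) (v : V) : V :=
  letI := G.decomp
  (DirectSum.decompose G.gr v n : V)

/-- `V_{≥n} = ⊕_{i ≥ n} V_i`. -/
def ge (G : GradedVA A) (n : ℤ) : Submodule K V := ⨆ i ≥ n, G.gr i

/-- `V_{≤n} = ⊕_{i ≤ n} V_i`. -/
def le (G : GradedVA A) (n : ℤ) : Submodule K V := ⨆ i ≤ n, G.gr i

/-- `J_1(V) = {a ∈ V_1 | a(0) = 0}`. -/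
def J1 (G : GradedVA A) : Set V :=
  {a : V | a ∈ G.gr 1 ∧ A.ncoef 0 a = 0}

/-- `Aut⁺V`: automorphisms `f` with `f(V_n) ⊆ V_{≥n}` and `pr_n ∘ f|_{V_n} = id`. -/
def AutPlus (G : GradedVA A) (f : V → V) : Prop :=
  A.IsVAAut f ∧ ∀ n : ℤ, ∀ v ∈ G.gr n, f v ∈ G.ge n ∧ G.pr n (f v) = v

/-- `Aut⁻V`: automorphisms `f` with `f(V_n) ⊆ ⊕_{k ≤ n} V_k` and `pr_n ∘ f|_{V_n} = id`. -/
def AutMinus (G : GradedVA A) (f : V → V) : Prop :=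
  A.IsVAAut f ∧ ∀ n : ℤ, ∀ v ∈ G.gr n, f v ∈ G.le n ∧ G.pr n (f v) = v

/-- `Aut⁰V`: automorphisms `f` with `f(V_n) ⊆ V_n`. -/
def AutZero (G : GradedVA A) (f : V → V) : Prop :=
  A.IsVAAut f ∧ ∀ n : ℤ, ∀ v ∈ G.gr n, f v ∈ G.gr n

end GradedVA

/-- A ℤ-graded conformal vertex algebra: a ℤ-graded vertex algebra with a conformal
vector `ω ∈ V_2` whose modes `L(n) = ω(n+1)` satisfy the Virasoro relations, with
`L(0)v = n v` for `v ∈ V_n` and `L(-1) = T`. -/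
structure ConfGVA {K V : Type*} [Field K] [AddCommGroup V] [Module K V] (A : VA K V)
    extends GradedVA A where
  /-- the conformal vector -/
  ω : V
  ω_mem : ω ∈ gr 2
  /-- the Virasoro relations `[L(n), L(m)] = (n-m)L(n+m) + δ_{n+m,0}((n³-n)/12)c` -/
  virasoro : ∃ c : K, ∀ n m : ℤ,
    A.ncoef (n + 1) ω ∘ₗ A.ncoef (m + 1) ω - A.ncoef (m + 1) ω ∘ₗ A.ncoef (n + 1) ω
      = ((n : K) - (m : K)) • A.ncoef (n + m + 1) ω
        + (if n + m = 0 then ((n : K) ^ 3 - (n : K)) / 12 * c else 0)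
            • (LinearMap.id : V →ₗ[K] V)
  /-- `L(0) v = n v` for `v ∈ V_n` -/
  L0_grading : ∀ n : ℤ, ∀ v ∈ gr n, A.ncoef 1 ω v = (n : K) • v
  /-- `L(-1) = T` -/
  Lneg1_eq_T : A.ncoef 0 ω = A.T

namespace ConfGVA

variable {K V : Type*} [Field K] [AddCommGroup V] [Module K V] {A : VA K V}

abbrev pr (C : ConfGVA A) : ℤ → V → V := C.toGradedVA.pr
abbrev ge (C : ConfGVA A) : ℤ → Submodule K V := C.toGradedVA.ge
abbrev le (C : ConfGVA A) : ℤ → Submodule K V := C.toGradedVA.le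
abbrev J1 (C : ConfGVA A) : Set V := C.toGradedVA.J1
abbrev AutPlus (C : ConfGVA A) : (V → V) → Prop := C.toGradedVA.AutPlus
abbrev AutMinus (C : ConfGVA A) : (V → V) → Prop := C.toGradedVA.AutMinus
abbrev AutZero (C : ConfGVA A) : (V → V) → Prop := C.toGradedVA.AutZero

/-- `Aut_ω V`: the VOA automorphisms, i.e. the stabilizer of `ω` in `Aut V`. -/
def AutOmega (C : ConfGVA A) (f : V → V) : Prop :=
  A.IsVAAut f ∧ f C.ω = C.ω

/-- An invariant bilinear form on `(V, ω)`:
`(a(n)b, c) = (-1)^d Σ_{j≥0} (1/j!) (b, (L(1)^j a)(2d-n-2-j) c)` for `a ∈ V_d`, which is the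
coefficient form of `(Y(a,z)b, c) = (b, Y(e^{zL(1)}(-z^{-2})^{L(0)} a, z^{-1}) c)`. -/
def IsInvForm (C : ConfGVA A) (B : V →ₗ[K] V →ₗ[K] K) : Prop :=
  ∀ d : ℤ, ∀ a ∈ C.gr d, ∀ (b c : V) (n : ℤ),
    B (A.ncoef n a b) c
      = ((d.negOnePow : ℤ) : K) *
          ∑ᶠ j : ℕ, (Nat.factorial j : K)⁻¹ *
            B b (A.ncoef (2 * d - n - 2 - (j : ℤ)) ((A.ncoef 2 C.ω ^ j) a) c)

end ConfGVA

/-- A VOA of CFT type: a ℤ-graded conformal vertex algebra with `V = ⊕_{n ∈ ℕ} V_n`,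
`dim V_n < ∞`, and `V_0 = K𝟙`. -/
structure VOACFT {K V : Type*} [Field K] [AddCommGroup V] [Module K V] (A : VA K V)
    extends ConfGVA A where
  gr_neg : ∀ n : ℤ, n < 0 → gr n = ⊥
  gr_fd : ∀ n : ℤ, FiniteDimensional K (gr n)
  gr_zero : gr 0 = Submodule.span K {A.vac}

namespace VOACFT

variable {K V : Type*} [Field K] [AddCommGroup V] [Module K V] {A : VA K V}

abbrev pr (W : VOACFT A) : ℤ → V → V := W.toConfGVA.pr
abbrev ge (W : VOACFT A) : ℤ → Submodule K V := W.toConfGVA.ge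
abbrev le (W : VOACFT A) : ℤ → Submodule K V := W.toConfGVA.le
abbrev J1 (W : VOACFT A) : Set V := W.toConfGVA.J1
abbrev AutPlus (W : VOACFT A) : (V → V) → Prop := W.toConfGVA.AutPlus
abbrev AutMinus (W : VOACFT A) : (V → V) → Prop := W.toConfGVA.AutMinus
abbrev AutZero (W : VOACFT A) : (V → V) → Prop := W.toConfGVA.AutZero
abbrev AutOmega (W : VOACFT A) : (V → V) → Prop := W.toConfGVA.AutOmega
abbrev IsInvForm (W : VOACFT A) : (V →ₗ[K] V →ₗ[K] K) → Prop := W.toConfGVA.IsInvForm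

end VOACFT

/-- A VOA of strong CFT type: a VOA of CFT type with `L(1)V_1 = 0`. -/
structure VOAsCFT {K V : Type*} [Field K] [AddCommGroup V] [Module K V] (A : VA K V)
    extends VOACFT A where
  L1_V1 : ∀ v ∈ gr 1, A.ncoef 2 ω v = 0

namespace VOAsCFT

variable {K V : Type*} [Field K] [AddCommGroup V] [Module K V] {A : VA K V}

abbrev pr (W : VOAsCFT A) : ℤ → V → V := W.toVOACFT.pr
abbrev ge (W : VOAsCFT A) : ℤ → Submodule K V := W.toVOACFT.ge
abbrev le (W : VOAsCFT A) : ℤ → Submodule K V := W.toVOACFT.le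
abbrev J1 (W : VOAsCFT A) : Set V := W.toVOACFT.J1
abbrev AutPlus (W : VOAsCFT A) : (V → V) → Prop := W.toVOACFT.AutPlus
abbrev AutMinus (W : VOAsCFT A) : (V → V) → Prop := W.toVOACFT.AutMinus
abbrev AutZero (W : VOAsCFT A) : (V → V) → Prop := W.toVOACFT.AutZero
abbrev AutOmega (W : VOAsCFT A) : (V → V) → Prop := W.toVOACFT.AutOmega
abbrev IsInvForm (W : VOAsCFT A) : (V →ₗ[K] V →ₗ[K] K) → Prop := W.toVOACFT.IsInvForm

end VOAsCFT

end

theorem finsum_eq_sum_range {M : Type*} [AddCommMonoid M] {f : ℕ → M} {N : ℕ}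
    (h : ∀ i, N ≤ i → f i = 0) : ∑ᶠ i, f i = ∑ i ∈ Finset.range N, f i := by
  refine finsum_eq_sum_of_support_subset _ fun i hi => ?_
  rw [Finset.coe_range, Set.mem_Iio]
  by_contra hc
  exact hi (h i (not_lt.mp hc))

section Binomial

variable {K : Type*} [Field K]

@[simp]
theorem zBinom_right_zero (m : ℤ) : zBinom K m 0 = 1 := by simp [zBinom]

theorem zBinom_eq_zero_of_lt {n i : ℕ} (h : n < i) : zBinom K n i = 0 := by
  rw [zBinom, Finset.prod_eq_zero (Finset.mem_range.mpr h) (by simp), zero_div]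

theorem zBinom_neg_one [CharZero K] (i : ℕ) : zBinom K (-1) i = (-1) ^ i := by
  rw [zBinom, div_eq_iff (by exact_mod_cast i.factorial_ne_zero)]
  induction i with
  | zero => simp
  | succ i ih =>
    rw [Finset.prod_range_succ, ih, Nat.factorial_succ]
    push_cast
    ring

theorem zBinom_neg_two [CharZero K] (i : ℕ) : zBinom K (-2) i = (-1) ^ i * (i + 1) := by
  rw [zBinom, div_eq_iff (by exact_mod_cast i.factorial_ne_zero)]
  induction i with
  | zero => simp
  | succ i ih =>
    rw [Finset.prod_range_succ, ih, Nat.factorial_succ]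
    push_cast
    ring

end Binomial

namespace VA

section Identities

variable {K V : Type*} [Field K] [AddCommGroup V] [Module K V] (A : VA K V)

theorem commutator (a b c : V) (m q : ℤ) :
    A.ncoef m a (A.ncoef q b c) - A.ncoef q b (A.ncoef m a c)
      = ∑ᶠ i : ℕ, zBinom K m i • A.ncoef (m + q - i) (A.ncoef i a b) c := by
  have h := A.borcherds a b c 0 q m
  rw [finsum_eq_sum_range (N := 1) (f := fun i : ℕ => ((-1 : K) ^ i * zBinom K 0 i) • _)] at h
  · simpa using h.symm
  · intro i hi
    have : zBinom K 0 i = 0 := by exact_mod_cast zBinom_eq_zero_of_lt (K := K) (n := 0) hi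
    simp [this]

theorem commutator_nat (a b c : V) (m : ℕ) (q : ℤ) :
    A.ncoef m a (A.ncoef q b c) - A.ncoef q b (A.ncoef m a c)
      = ∑ i ∈ Finset.range (m + 1),
          zBinom K m i • A.ncoef (m + q - i) (A.ncoef i a b) c := by
  rw [commutator, finsum_eq_sum_range (N := m + 1)]
  intro i hi
  rw [zBinom_eq_zero_of_lt hi, zero_smul]

theorem commutator_zero (a b c : V) (q : ℤ) :
    A.ncoef 0 a (A.ncoef q b c) - A.ncoef q b (A.ncoef 0 a c)
      = A.ncoef q (A.ncoef 0 a b) c := by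
  simpa using A.commutator_nat a b c 0 q

theorem commutator_one (a b c : V) (q : ℤ) :
    A.ncoef 1 a (A.ncoef q b c) - A.ncoef q b (A.ncoef 1 a c)
      = A.ncoef (q + 1) (A.ncoef 0 a b) c + A.ncoef q (A.ncoef 1 a b) c := by
  have h := A.commutator_nat a b c 1 q
  simpa [Finset.sum_range_succ, zBinom, add_comm q 1] using h

theorem commutator_two [CharZero K] (a b c : V) (q : ℤ) :
    A.ncoef 2 a (A.ncoef q b c) - A.ncoef q b (A.ncoef 2 a c)
      = A.ncoef (q + 2) (A.ncoef 0 a b) c + (2 : K) • A.ncoef (q + 1) (A.ncoef 1 a b) c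
        + A.ncoef q (A.ncoef 2 a b) c := by
  have h := A.commutator_nat a b c 2 q
  have e₁ : zBinom K 2 1 = 2 := by simp [zBinom]
  have e₂ : zBinom K 2 2 = 1 := by
    norm_num [zBinom, Finset.prod_range_succ]
  simp only [Finset.sum_range_succ, Finset.sum_range_zero, Nat.cast_ofNat, e₁, e₂,
    zBinom_right_zero, Nat.cast_zero, Nat.cast_one, zero_add, one_smul] at h
  rw [h, show 2 + q - 0 = q + 2 by ring, show 2 + q - 1 = q + 1 by ring,
    show 2 + q - 2 = q by ring]

theorem T_apply (a : V) : A.T a = A.ncoef (-2) a A.vac := rfl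

theorem ncoef_T [CharZero K] (n : ℤ) (a c : V) :
    A.ncoef n (A.T a) c = -(n : K) • A.ncoef (n - 1) a c := by
  have h := A.borcherds a A.vac c (-2) n 0
  rw [finsum_eq_sum_range (N := 1) (f := fun i : ℕ => zBinom K 0 i • _)] at h
  swap
  · intro i hi
    have : zBinom K 0 i = 0 := by exact_mod_cast zBinom_eq_zero_of_lt (K := K) (n := 0) hi
    rw [this, zero_smul]
  simp only [Finset.sum_range_one, zBinom_right_zero, one_smul, Nat.cast_zero, add_zero, zero_add,
    sub_zero, zBinom_neg_two, A.vac_ncoef] at h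
  rw [T_apply, h]
  rcases lt_trichotomy n 0 with hn | rfl | hn
  · obtain ⟨k, rfl⟩ : ∃ k : ℕ, n = -1 - k := ⟨(-1 - n).toNat, by omega⟩
    rw [finsum_eq_single _ k]
    · rw [if_pos (by omega), if_neg (by omega), smul_zero, sub_zero]
      have : (-2 - k : ℤ) = -1 - k - 1 := by omega
      rw [this, ← mul_assoc, ← mul_pow]
      congr 1
      simp
    · intro i hi
      rw [if_neg (by omega), if_neg (by omega)]
      simp
  · rw [finsum_eq_sum_range (N := 0)]
    · simp
    · intro i _
      rw [if_neg (by omega), if_neg (by omega)]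
      simp
  · obtain ⟨k, rfl⟩ : ∃ k : ℕ, n = k + 1 := ⟨(n - 1).toNat, by omega⟩
    rw [finsum_eq_single _ k]
    · rw [if_neg (by omega), if_pos (by omega), map_zero, zero_sub,
        Int.negOnePow_even _ (by decide), ← mul_assoc, ← mul_pow, ← smul_neg]
      simp [← neg_smul]
    · intro i hi
      rw [if_neg (by omega), if_neg (by omega)]
      simp

theorem ncoef_vac_neg [CharZero K] (i : ℕ) (x : V) :
    A.ncoef (-1 - i) x A.vac = (i.factorial : K)⁻¹ • (A.T ^ i) x := by
  induction i generalizing x with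
  | zero => simp [A.ncoef_vac]
  | succ i ih =>
    have h := A.ncoef_T (-1 - i) x A.vac
    have hi : ((i : K) + 1) ≠ 0 := by exact_mod_cast i.succ_ne_zero
    rw [ih] at h
    have e : (-1 - ((i + 1 : ℕ) : ℤ)) = -1 - i - 1 := by omega
    rw [e, pow_succ, Module.End.mul_apply, Nat.factorial_succ, Nat.cast_mul, mul_inv, mul_smul, h,
      smul_smul]
    push_cast
    rw [show ((i : K) + 1)⁻¹ * -(-1 - (i : K)) = 1 by field_simp; ring, one_smul]

theorem skew_symmetry [CharZero K] (a b : V) (p : ℤ) :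
    A.ncoef p b a = (((p + 1).negOnePow : ℤ) : K) •
      ∑ᶠ i : ℕ, ((-1 : K) ^ i * (i.factorial : K)⁻¹) • (A.T ^ i) (A.ncoef (p + i) a b) := by
  have h := A.borcherds a b A.vac p 0 (-1)
  rw [finsum_eq_sum_range (N := 1) (f := fun i : ℕ => ((-1 : K) ^ i * zBinom K p i) • _)] at h
  swap
  · intro i hi
    rw [A.ncoef_vac_zero (0 + i) (by omega), A.ncoef_vac_zero (-1 + i) (by omega)]
    simp
  simp only [Finset.sum_range_one, zBinom_right_zero, zBinom_neg_one, Nat.cast_zero, add_zero,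
    sub_zero, A.ncoef_vac, A.ncoef_vac_zero 0 le_rfl, map_zero, zero_sub, pow_zero, mul_one,
    one_smul, ncoef_vac_neg, smul_smul] at h
  rw [h, ← neg_smul, smul_smul, Int.negOnePow_succ]
  rcases Int.even_or_odd p with hp | hp
  · simp [Int.negOnePow_even _ hp]
  · simp [Int.negOnePow_odd _ hp]

end Identities

end VA

namespace VA

section Ideals

variable {K V : Type*} [Field K] [AddCommGroup V] [Module K V] (A : VA K V)

/-- The left submodule generated by `x`: the span of all `u(n)x`. -/
def leftSpan (x : V) : Submodule K V :=
  Submodule.span K {y | ∃ (n : ℤ) (u : V), A.ncoef n u x = y}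

theorem ncoef_mem_leftSpan (n : ℤ) (u x : V) : A.ncoef n u x ∈ A.leftSpan x :=
  Submodule.subset_span ⟨n, u, rfl⟩

theorem ncoef_ncoef_mem_leftSpan (x u w : V) (n k : ℤ) :
    A.ncoef k w (A.ncoef n u x) ∈ A.leftSpan x := by
  obtain ⟨N, hN⟩ := A.trunc u x
  obtain ⟨M, hM⟩ := A.trunc w x
  suffices h : ∀ (r : ℕ) (n k : ℤ), N ≤ n + r → A.ncoef k w (A.ncoef n u x) ∈ A.leftSpan x from
    h (N - n).toNat n k (by omega)
  intro r
  induction r with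
  | zero => intro n k hn; rw [hN n (by simpa using hn), map_zero]; exact zero_mem _
  | succ r ih =>
    intro n k hn
    have h := A.borcherds w u x (k - M) n M
    rw [finsum_eq_sum_range (N := r + 1)
      (f := fun i : ℕ => ((-1 : K) ^ i * zBinom K (k - M) i) • _), Finset.sum_range_succ'] at h
    swap
    · intro i hi
      rw [hN (n + i) (by push_cast at hn; omega), hM (M + i) (by omega)]
      simp
    simp only [zBinom_right_zero, pow_zero, mul_one, one_smul, Nat.cast_zero, add_zero, sub_zero,
      hM M le_rfl, map_zero, smul_zero, add_sub_cancel] at h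
    rw [← sub_eq_iff_eq_add'] at h
    rw [← h]
    refine sub_mem ?_ (sum_mem fun i _ => Submodule.smul_mem _ _ ?_)
    · refine finsum_induction (· ∈ A.leftSpan x) (zero_mem _) (fun _ _ => add_mem) fun i => ?_
      exact Submodule.smul_mem _ _ (A.ncoef_mem_leftSpan _ _ _)
    · rw [hM _ (by omega), map_zero, smul_zero, sub_zero]
      exact ih _ _ (by push_cast at hn ⊢; omega)

theorem ncoef_mem_leftSpan_of_mem (x w : V) (k : ℤ) {y : V} (hy : y ∈ A.leftSpan x) :
    A.ncoef k w y ∈ A.leftSpan x := by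
  induction hy using Submodule.span_induction with
  | mem y hy => obtain ⟨n, u, rfl⟩ := hy; exact A.ncoef_ncoef_mem_leftSpan x u w n k
  | zero => rw [map_zero]; exact zero_mem _
  | add y z _ _ hy hz => rw [map_add]; exact add_mem hy hz
  | smul c y _ hy => rw [map_smul]; exact Submodule.smul_mem _ _ hy

theorem self_mem_leftSpan (x : V) : x ∈ A.leftSpan x := by
  have := A.ncoef_mem_leftSpan (-1) A.vac x
  rwa [A.vac_ncoef, if_pos rfl] at this

theorem isIdeal_leftSpan [CharZero K] (x ω : V) (hω : A.ncoef 0 ω = A.T) : A.IsIdeal (A.leftSpan x) := by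
  intro n a b hb
  refine ⟨A.ncoef_mem_leftSpan_of_mem x a n hb, ?_⟩
  rw [A.skew_symmetry]
  refine Submodule.smul_mem _ _ (finsum_induction (· ∈ A.leftSpan x) (zero_mem _)
    (fun _ _ => add_mem) fun i => Submodule.smul_mem _ _ ?_)
  induction i with
  | zero => exact A.ncoef_mem_leftSpan_of_mem x a _ hb
  | succ i _ =>
    generalize n + ((i + 1 : ℕ) : ℤ) = k
    have hT : ∀ y ∈ A.leftSpan x, A.T y ∈ A.leftSpan x := fun y hy => by
      rw [← hω]; exact A.ncoef_mem_leftSpan_of_mem x ω 0 hy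
    induction i + 1 with
    | zero => exact A.ncoef_mem_leftSpan_of_mem x a _ hb
    | succ j ih => rw [pow_succ', Module.End.mul_apply]; exact hT _ ih

end Ideals

end VA

namespace GradedVA

section Projections

variable {K V : Type*} [Field K] [AddCommGroup V] [Module K V] {A : VA K V} (G : GradedVA A)

/-- The projection `pr_n` as a linear map. -/
def prₗ (n : ℤ) : V →ₗ[K] V :=
  letI := G.decomp
  (G.gr n).subtype ∘ₗ DirectSum.component K ℤ (fun i => G.gr i) n ∘ₗ
    (DirectSum.decomposeLinearEquiv G.gr).toLinearMap

theorem prₗ_apply (n : ℤ) (v : V) : G.prₗ n v = G.pr n v := rfl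

theorem prₗ_mem (n : ℤ) (v : V) : G.prₗ n v ∈ G.gr n :=
  letI := G.decomp
  (DirectSum.decompose G.gr v n).2

theorem prₗ_same {n : ℤ} {v : V} (hv : v ∈ G.gr n) : G.prₗ n v = v :=
  letI := G.decomp
  DirectSum.decompose_of_mem_same G.gr hv

theorem prₗ_ne {m n : ℤ} {v : V} (hv : v ∈ G.gr m) (h : m ≠ n) : G.prₗ n v = 0 :=
  letI := G.decomp
  DirectSum.decompose_of_mem_ne G.gr hv h

theorem exists_finset_sum_prₗ (v : V) : ∃ s : Finset ℤ, (∀ n ∉ s, G.prₗ n v = 0) ∧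
    ∑ n ∈ s, G.prₗ n v = v := by
  classical
  let _ := G.decomp
  refine ⟨(DirectSum.decompose G.gr v).support, fun n hn => ?_,
    DirectSum.sum_support_decompose G.gr v⟩
  rw [DFinsupp.notMem_support_iff] at hn
  exact congrArg Subtype.val hn

@[elab_as_elim]
theorem homogeneous_induction {p : V → Prop} (zero : p 0)
    (homogeneous : ∀ n, ∀ v ∈ G.gr n, p v) (add : ∀ v w, p v → p w → p (v + w)) (v : V) : p v := by
  obtain ⟨s, -, hs⟩ := G.exists_finset_sum_prₗ v
  rw [← hs]
  exact Finset.sum_induction _ p add zero fun n _ => homogeneous n _ (G.prₗ_mem n v)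

theorem ext_prₗ {v w : V} (h : ∀ n, G.prₗ n v = G.prₗ n w) : v = w := by
  rw [← sub_eq_zero]
  obtain ⟨s, -, hs⟩ := G.exists_finset_sum_prₗ (v - w)
  rw [← hs]
  exact Finset.sum_eq_zero fun n _ => by rw [map_sub, h, sub_self]

theorem eq_zero_of_prₗ {v : V} (h : ∀ n, G.prₗ n v = 0) : v = 0 :=
  G.ext_prₗ fun n => by rw [h, map_zero]

theorem mem_gr_of_prₗ {n : ℤ} {v : V} (h : ∀ m, m ≠ n → G.prₗ m v = 0) : v ∈ G.gr n := by
  have : v = G.prₗ n v := G.ext_prₗ fun m => by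
    rcases eq_or_ne m n with rfl | hm
    · rw [G.prₗ_same (G.prₗ_mem m v)]
    · rw [h m hm, G.prₗ_ne (G.prₗ_mem n v) hm.symm]
  rw [this]
  exact G.prₗ_mem n v

/-- A nonzero vector has a component of lowest degree. -/
theorem exists_lowest {v : V} (hv : v ≠ 0) :
    ∃ m, G.prₗ m v ≠ 0 ∧ ∀ i < m, G.prₗ i v = 0 := by
  classical
  obtain ⟨s, hs, -⟩ := G.exists_finset_sum_prₗ v
  have hne : (s.filter fun n => G.prₗ n v ≠ 0).Nonempty := by
    by_contra hc
    rw [Finset.not_nonempty_iff_eq_empty, Finset.filter_eq_empty_iff] at hc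
    refine hv (G.eq_zero_of_prₗ fun n => ?_)
    by_cases hn : n ∈ s
    · exact not_not.mp (hc hn)
    · exact hs n hn
  refine ⟨_, (Finset.mem_filter.mp (Finset.min'_mem _ hne)).2, fun i hi => ?_⟩
  by_contra hc
  refine absurd (Finset.min'_le _ i (Finset.mem_filter.mpr ⟨?_, hc⟩)) (not_le.mpr hi)
  by_contra his
  exact hc (hs i his)

/-- A nonzero vector has a component of highest degree. -/
theorem exists_highest {v : V} (hv : v ≠ 0) :
    ∃ m, G.prₗ m v ≠ 0 ∧ ∀ i, m < i → G.prₗ i v = 0 := by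
  classical
  obtain ⟨s, hs, -⟩ := G.exists_finset_sum_prₗ v
  have hne : (s.filter fun n => G.prₗ n v ≠ 0).Nonempty := by
    by_contra hc
    rw [Finset.not_nonempty_iff_eq_empty, Finset.filter_eq_empty_iff] at hc
    refine hv (G.eq_zero_of_prₗ fun n => ?_)
    by_cases hn : n ∈ s
    · exact not_not.mp (hc hn)
    · exact hs n hn
  refine ⟨_, (Finset.mem_filter.mp (Finset.max'_mem _ hne)).2, fun i hi => ?_⟩
  by_contra hc
  refine absurd (Finset.le_max' _ i (Finset.mem_filter.mpr ⟨?_, hc⟩)) (not_le.mpr hi)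
  by_contra his
  exact hc (hs i his)

theorem mem_ge_iff {n : ℤ} {v : V} : v ∈ G.ge n ↔ ∀ i < n, G.prₗ i v = 0 := by
  constructor
  · intro hv i hi
    have : G.ge n ≤ LinearMap.ker (G.prₗ i) :=
      iSup₂_le fun j hj x hx => G.prₗ_ne hx (by omega)
    exact this hv
  · intro h
    obtain ⟨s, -, hs⟩ := G.exists_finset_sum_prₗ v
    rw [← hs]
    refine sum_mem fun j _ => ?_
    by_cases hj : n ≤ j
    · exact le_iSup₂ (f := fun i (_ : i ≥ n) => G.gr i) j hj (G.prₗ_mem j v)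
    · rw [h j (by omega)]; exact zero_mem _

theorem mem_le_iff {n : ℤ} {v : V} : v ∈ G.le n ↔ ∀ i, n < i → G.prₗ i v = 0 := by
  constructor
  · intro hv i hi
    have : G.le n ≤ LinearMap.ker (G.prₗ i) :=
      iSup₂_le fun j hj x hx => G.prₗ_ne hx (by omega)
    exact this hv
  · intro h
    obtain ⟨s, -, hs⟩ := G.exists_finset_sum_prₗ v
    rw [← hs]
    refine sum_mem fun j _ => ?_
    by_cases hj : j ≤ n
    · exact le_iSup₂ (f := fun i (_ : i ≤ n) => G.gr i) j hj (G.prₗ_mem j v)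
    · rw [h j (by omega)]; exact zero_mem _

theorem mem_ge_of_mem {n : ℤ} {v : V} (hv : v ∈ G.gr n) : v ∈ G.ge n :=
  G.mem_ge_iff.mpr fun _ hi => G.prₗ_ne hv (by omega)

theorem mem_le_of_mem {n : ℤ} {v : V} (hv : v ∈ G.gr n) : v ∈ G.le n :=
  G.mem_le_iff.mpr fun _ hi => G.prₗ_ne hv (by omega)

theorem ge_anti {m n : ℤ} (h : m ≤ n) : G.ge n ≤ G.ge m := fun _ hv =>
  G.mem_ge_iff.mpr fun i hi => G.mem_ge_iff.mp hv i (by omega)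

theorem le_mono {m n : ℤ} (h : m ≤ n) : G.le m ≤ G.le n := fun _ hv =>
  G.mem_le_iff.mpr fun i hi => G.mem_le_iff.mp hv i (by omega)

theorem mem_gr_of_mem_ge_of_mem_le {n : ℤ} {v : V} (h₁ : v ∈ G.ge n) (h₂ : v ∈ G.le n) :
    v ∈ G.gr n :=
  G.mem_gr_of_prₗ fun m hm => by
    rcases lt_or_gt_of_ne hm with h | h
    · exact G.mem_ge_iff.mp h₁ m h
    · exact G.mem_le_iff.mp h₂ m h

/-- An additive property holds on `V_{≥n}` if it holds on each `V_i`, `i ≥ n`. -/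
theorem ge_induction {n : ℤ} {p : V → Prop} (zero : p 0)
    (homogeneous : ∀ i, n ≤ i → ∀ v ∈ G.gr i, p v) (add : ∀ v w, p v → p w → p (v + w))
    {v : V} (hv : v ∈ G.ge n) : p v := by
  obtain ⟨s, -, hs⟩ := G.exists_finset_sum_prₗ v
  rw [← hs]
  refine Finset.sum_induction _ p add zero fun i _ => ?_
  by_cases hi : n ≤ i
  · exact homogeneous i hi _ (G.prₗ_mem i v)
  · rw [G.mem_ge_iff.mp hv i (by omega)]; exact zero

/-- The lowest component of a product is the product of the lowest components. -/
theorem ncoef_mem_ge {i j k : ℤ} {x y : V} (hx : x ∈ G.ge i) (hy : y ∈ G.ge j) :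
    A.ncoef k x y ∈ G.ge (i + j - k - 1) ∧
      G.prₗ (i + j - k - 1) (A.ncoef k x y) = A.ncoef k (G.prₗ i x) (G.prₗ j y) := by
  refine G.ge_induction (p := fun x => A.ncoef k x y ∈ G.ge (i + j - k - 1) ∧
    G.prₗ (i + j - k - 1) (A.ncoef k x y) = A.ncoef k (G.prₗ i x) (G.prₗ j y))
    (by simp) (fun m hm x hxm => ?_) (fun x x' hx hx' => ?_) hx
  swap
  · simp only [map_add, LinearMap.add_apply]
    exact ⟨add_mem hx.1 hx'.1, by rw [hx.2, hx'.2]⟩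
  refine G.ge_induction (p := fun y => A.ncoef k x y ∈ G.ge (i + j - k - 1) ∧
    G.prₗ (i + j - k - 1) (A.ncoef k x y) = A.ncoef k (G.prₗ i x) (G.prₗ j y))
    (by simp) (fun l hl y hyl => ?_) (fun y y' hy hy' => ?_) hy
  swap
  · simp only [map_add]
    exact ⟨add_mem hy.1 hy'.1, by rw [hy.2, hy'.2]⟩
  have h := G.ncoef_mem m l k x hxm y hyl
  refine ⟨G.ge_anti (by omega) (G.mem_ge_of_mem h), ?_⟩
  by_cases h' : m = i ∧ l = j
  · obtain ⟨rfl, rfl⟩ := h'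
    rw [G.prₗ_same h, G.prₗ_same hxm, G.prₗ_same hyl]
  · rw [G.prₗ_ne h (by omega)]
    rcases not_and_or.mp h' with h' | h'
    · rw [G.prₗ_ne hxm h', map_zero, LinearMap.zero_apply]
    · rw [G.prₗ_ne hyl h', map_zero]

/-- A homogeneous operator commutes with projections up to the degree shift. -/
theorem prₗ_ncoef {i k : ℤ} {x : V} (hx : x ∈ G.gr i) (y : V) (n : ℤ) :
    G.prₗ (i + n - k - 1) (A.ncoef k x y) = A.ncoef k x (G.prₗ n y) := by
  induction y using G.homogeneous_induction with
  | zero => simp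
  | add y y' hy hy' => simp only [map_add, hy, hy']
  | homogeneous m y hy =>
    have h := G.ncoef_mem i m k x hx y hy
    rcases eq_or_ne m n with rfl | hm
    · rw [G.prₗ_same h, G.prₗ_same hy]
    · rw [G.prₗ_ne h (by omega), G.prₗ_ne hy hm, map_zero]

theorem prₗ_ncoef_left {j k : ℤ} {y : V} (hy : y ∈ G.gr j) (x : V) (n : ℤ) :
    G.prₗ (n + j - k - 1) (A.ncoef k x y) = A.ncoef k (G.prₗ n x) y := by
  induction x using G.homogeneous_induction with
  | zero => simp
  | add x x' hx hx' => simp only [map_add, LinearMap.add_apply, hx, hx']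
  | homogeneous m x hx =>
    have h := G.ncoef_mem m j k x hx y hy
    rcases eq_or_ne m n with rfl | hm
    · rw [G.prₗ_same h, G.prₗ_same hx]
    · rw [G.prₗ_ne h (by omega), G.prₗ_ne hx hm, map_zero, LinearMap.zero_apply]

theorem T_mem {n : ℤ} {v : V} (hv : v ∈ G.gr n) : A.T v ∈ G.gr (n + 1) := by
  have := G.ncoef_mem n 0 (-2) v hv _ G.vac_mem
  rw [VA.T_apply]
  convert this using 2
  ring

theorem prₗ_T (v : V) (n : ℤ) : G.prₗ (n + 1) (A.T v) = A.T (G.prₗ n v) := by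
  have := G.prₗ_ncoef_left (k := -2) G.vac_mem v n
  rw [VA.T_apply, VA.T_apply, ← this]
  congr 2
  ring

end Projections

end GradedVA

namespace VOAsCFT

section Structure

variable {K V : Type*} [Field K] [AddCommGroup V] [Module K V] {A : VA K V}
  (W : VOAsCFT A)

theorem prₗ_neg {i : ℤ} (hi : i < 0) (v : V) : W.prₗ i v = 0 := by
  have := W.prₗ_mem i v
  rwa [W.gr_neg i hi, Submodule.mem_bot] at this

theorem eq_zero_of_mem_neg {i : ℤ} (hi : i < 0) {v : V} (hv : v ∈ W.gr i) : v = 0 := by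
  rwa [W.gr_neg i hi, Submodule.mem_bot] at hv

theorem mem_ge_zero (v : V) : v ∈ W.ge 0 :=
  W.mem_ge_iff.mpr fun _ hi => W.prₗ_neg hi v

theorem exists_eq_smul_vac {v : V} (hv : v ∈ W.gr 0) : ∃ c : K, c • A.vac = v := by
  rwa [W.gr_zero, Submodule.mem_span_singleton] at hv

theorem ncoef_eq_zero_of_mem_gr_zero {v : V} (hv : v ∈ W.gr 0) (u : V) {n : ℤ} (hn : 0 ≤ n) :
    A.ncoef n u v = 0 := by
  obtain ⟨c, rfl⟩ := W.exists_eq_smul_vac hv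
  rw [map_smul, A.ncoef_vac_zero n hn, smul_zero]

theorem ncoef_left_eq_zero_of_mem_gr_zero {v : V} (hv : v ∈ W.gr 0) (u : V) {n : ℤ} (hn : n ≠ -1) :
    A.ncoef n v u = 0 := by
  obtain ⟨c, rfl⟩ := W.exists_eq_smul_vac hv
  rw [map_smul, LinearMap.smul_apply, A.vac_ncoef, if_neg hn, smul_zero]

theorem T_eq_zero_of_mem_gr_zero {v : V} (hv : v ∈ W.gr 0) : A.T v = 0 :=
  W.ncoef_left_eq_zero_of_mem_gr_zero hv _ (by decide)

variable [CharZero K]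

theorem eq_zero_of_T_eq_zero {n : ℤ} (hn : n ≠ 0) {v : V} (hv : v ∈ W.gr n) (h : A.T v = 0) :
    v = 0 := by
  have h₁ : A.ncoef 1 W.ω v = 0 := by
    rw [A.skew_symmetry, finsum_eq_sum_range (N := 0), Finset.sum_range_zero, smul_zero]
    intro i _
    have h₂ := A.ncoef_T (2 + i) v W.ω
    rw [h, map_zero, LinearMap.zero_apply, eq_comm, smul_eq_zero, neg_eq_zero] at h₂
    rw [show (1 + i : ℤ) = 2 + i - 1 by ring, h₂.resolve_left (by norm_cast; omega), map_zero,
      smul_zero]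
  rw [W.L0_grading n v hv, smul_eq_zero] at h₁
  exact h₁.resolve_left (by exact_mod_cast hn)

theorem exists_T_eq {n : ℤ} (hn : 2 ≤ n) {v : V} (hv : v ∈ W.gr n) (h : A.ncoef 0 v = 0) :
    ∃ b ∈ W.gr (n - 1), A.T b = v := by
  obtain ⟨N, hN⟩ := A.trunc W.ω v
  have h₁ := A.skew_symmetry W.ω v 0
  rw [h, LinearMap.zero_apply, finsum_eq_sum_range (N := N.toNat + 2), Finset.sum_range_succ',
    Finset.sum_range_succ'] at h₁
  swap
  · intro i hi
    rw [hN _ (by omega), map_zero, smul_zero]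
  set z := ∑ i ∈ Finset.range N.toNat, ((-1 : K) ^ (i + 1 + 1) * ((i + 1 + 1).factorial : K)⁻¹) •
    (A.T ^ i) (A.ncoef (0 + ((i + 1 + 1 : ℕ) : ℤ)) W.ω v) with hz
  have h₂ : ∑ i ∈ Finset.range N.toNat, ((-1 : K) ^ (i + 1 + 1) * ((i + 1 + 1).factorial : K)⁻¹) •
      (A.T ^ (i + 1 + 1)) (A.ncoef (0 + ((i + 1 + 1 : ℕ) : ℤ)) W.ω v) = A.T (A.T z) := by
    simp only [hz, map_sum, map_smul, pow_succ', Module.End.mul_apply]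
  rw [h₂] at h₁
  simp only [zero_add, Nat.cast_one, Nat.cast_zero, pow_zero, pow_one, Nat.factorial_one,
    Nat.factorial_zero, inv_one, mul_one, one_smul, W.L0_grading n v hv, W.Lneg1_eq_T,
    Module.End.one_apply] at h₁
  have h₃ : A.T (A.T z - ((n : K) - 1) • v) = 0 := by
    simp only [map_sub, map_smul]
    rw [eq_comm, smul_eq_zero] at h₁
    have h₁ := h₁.resolve_left (by simp)
    simp only [map_smul] at h₁
    rw [← h₁]
    module
  have h₄ : A.T (W.prₗ (n - 1) z) - ((n : K) - 1) • v = 0 := by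
    refine W.eq_zero_of_T_eq_zero (n := n) (by omega) ?_ ?_
    · refine sub_mem ?_ (Submodule.smul_mem _ _ hv)
      simpa using W.T_mem (W.prₗ_mem (n - 1) z)
    · have := congrArg (W.prₗ (n + 1)) h₃
      rw [W.prₗ_T, map_sub, map_smul, W.prₗ_same hv, map_zero] at this
      rw [← W.prₗ_T, sub_add_cancel]
      exact this
  have hn' : (n : K) - 1 ≠ 0 := by
    rw [sub_ne_zero]; exact_mod_cast (by omega : n ≠ 1)
  refine ⟨((n : K) - 1)⁻¹ • W.prₗ (n - 1) z, Submodule.smul_mem _ _ (W.prₗ_mem _ _), ?_⟩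
  rw [map_smul, sub_eq_zero.mp h₄, smul_smul, inv_mul_cancel₀ hn', one_smul]

theorem ncoef_one_ω {c : V} (hc : c ∈ W.gr 1) : A.ncoef 1 c W.ω = c := by
  rw [A.skew_symmetry, finsum_eq_sum_range (N := 1)]
  · rw [Finset.sum_range_one, Nat.cast_zero, add_zero, W.L0_grading 1 c hc,
      Int.negOnePow_even _ (by decide)]
    simp
  · intro i hi
    have : A.ncoef (1 + i) W.ω c = 0 := by
      rcases eq_or_ne i 1 with rfl | hi'
      · exact W.L1_V1 c hc
      · exact W.eq_zero_of_mem_neg (by omega) (W.ncoef_mem _ _ (1 + i) _ W.ω_mem _ hc)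
    rw [this, map_zero, smul_zero]

/-- If `b ∈ V_1` pairs trivially with `V_1`, then it pairs trivially with every `V_n`. -/
theorem ncoef_eq_zero_of_radical {b : V} (hb : b ∈ W.gr 1)
    (h : ∀ y ∈ W.gr 1, A.ncoef 1 b y = 0) (n : ℕ) :
    ∀ u ∈ W.gr n, A.ncoef n b u = 0 := by
  induction n with
  | zero => exact fun u hu => W.ncoef_eq_zero_of_mem_gr_zero hu b le_rfl
  | succ n ih =>
    rcases n.eq_zero_or_pos with rfl | hn
    · exact h
    intro u hu
    have h₁ := A.commutator_two W.ω b u n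
    have h₂ : A.ncoef 2 W.ω (A.ncoef n b u) = 0 := by
      refine W.L1_V1 _ ?_
      have := W.ncoef_mem _ _ n _ hb _ hu
      convert this using 2
      push_cast; ring
    have h₃ : A.ncoef n b (A.ncoef 2 W.ω u) = 0 := by
      refine ih _ ?_
      have := W.ncoef_mem _ _ 2 _ W.ω_mem _ hu
      convert this using 2
      push_cast; ring
    rw [h₂, h₃, W.L1_V1 b hb, W.Lneg1_eq_T, W.L0_grading 1 b hb, A.ncoef_T, map_zero,
      LinearMap.zero_apply, show (n + 2 - 1 : ℤ) = n + 1 by ring] at h₁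
    have h₄ : (n : K) • A.ncoef (n + 1) b u = 0 := by
      rw [← neg_eq_zero, ← neg_smul]
      simp only [sub_zero, Int.cast_one, one_smul, add_zero] at h₁
      rw [eq_comm, ← add_smul] at h₁
      rw [← h₁]
      congr 1
      push_cast
      ring
    rw [smul_eq_zero] at h₄
    exact_mod_cast h₄.resolve_left (by exact_mod_cast hn.ne')

theorem eq_zero_of_radical (hs : A.IsSimple) {b : V} (hb : b ∈ W.gr 1)
    (h : ∀ y ∈ W.gr 1, A.ncoef 1 b y = 0) : b = 0 := by
  have h₁ : ∀ (u : V) (n : ℤ), W.prₗ 0 (A.ncoef n b u) = 0 := by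
    intro u n
    have h₂ := W.prₗ_ncoef (k := n) hb u n
    rw [show 1 + n - n - 1 = 0 by ring] at h₂
    rw [h₂]
    rcases lt_or_ge n 0 with hn | hn
    · rw [W.prₗ_neg hn, map_zero]
    · lift n to ℕ using hn
      exact W.ncoef_eq_zero_of_radical hb h n _ (W.prₗ_mem _ _)
  have h₂ : A.leftSpan b ≤ LinearMap.ker (W.prₗ 0) := by
    refine Submodule.span_le.mpr ?_
    rintro _ ⟨n, u, rfl⟩
    rw [SetLike.mem_coe, A.skew_symmetry]
    refine Submodule.smul_mem _ _ (finsum_induction (· ∈ LinearMap.ker (W.prₗ 0)) (zero_mem _)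
      (fun _ _ => add_mem) fun i => Submodule.smul_mem _ _ ?_)
    rw [LinearMap.mem_ker]
    cases i with
    | zero => exact h₁ _ _
    | succ i =>
      rw [pow_succ', Module.End.mul_apply]
      have := W.prₗ_T ((A.T ^ i) (A.ncoef (n + ((i + 1 : ℕ) : ℤ)) b u)) (-1)
      rw [W.prₗ_neg (i := -1) (by decide), map_zero] at this
      exact this
  have hb' := A.self_mem_leftSpan b
  rcases hs _ (A.isIdeal_leftSpan b W.ω W.Lneg1_eq_T) with h₃ | h₃
  · rwa [h₃, Submodule.mem_bot] at hb'
  · have h₄ : A.vac = 0 := by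
      rw [← W.prₗ_same W.vac_mem]
      exact h₂ (h₃ ▸ Submodule.mem_top)
    rw [← A.ncoef_vac b, h₄, map_zero]

end Structure

end VOAsCFT

section Exponential

variable {K V : Type*} [Field K] [AddCommGroup V] [Module K V] {D : V →ₗ[K] V}

theorem expOp_eq_sum {v : V} {N : ℕ} (h : ∀ i, N ≤ i → (D ^ i) v = 0) :
    expOp D v = ∑ i ∈ Finset.range N, (i.factorial : K)⁻¹ • (D ^ i) v :=
  finsum_eq_sum_range fun i hi => by rw [h i hi, smul_zero]

theorem pow_apply_eq_zero_of_le {v : V} {N : ℕ} (h : (D ^ N) v = 0) {i : ℕ} (hi : N ≤ i) :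
    (D ^ i) v = 0 := by
  rw [← Nat.sub_add_cancel hi, pow_add, Module.End.mul_apply, h, map_zero]

theorem expOp_add (hD : ∀ v, ∃ N, (D ^ N) v = 0) (v w : V) :
    expOp D (v + w) = expOp D v + expOp D w := by
  obtain ⟨N, hN⟩ := hD v
  obtain ⟨M, hM⟩ := hD w
  have hv : ∀ i, max N M ≤ i → (D ^ i) v = 0 := fun i hi =>
    pow_apply_eq_zero_of_le hN ((le_max_left _ _).trans hi)
  have hw : ∀ i, max N M ≤ i → (D ^ i) w = 0 := fun i hi =>
    pow_apply_eq_zero_of_le hM ((le_max_right _ _).trans hi)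
  rw [expOp_eq_sum hv, expOp_eq_sum hw, expOp_eq_sum (N := max N M), ← Finset.sum_add_distrib]
  · simp only [map_add, smul_add]
  · intro i hi
    rw [map_add, hv i hi, hw i hi, add_zero]

theorem expOp_smul (c : K) (v : V) : expOp D (c • v) = c • expOp D v := by
  rw [expOp, expOp, smul_finsum]
  exact finsum_congr fun i => by rw [map_smul, smul_comm]

theorem expOp_of_eq_zero {v : V} (h : D v = 0) : expOp D v = v := by
  rw [expOp_eq_sum (N := 1)]
  · simp
  · exact fun i hi => pow_apply_eq_zero_of_le (N := 1) (by simpa using h) hi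

theorem leibniz_pow_apply {β : V →ₗ[K] V →ₗ[K] V}
    (hβ : ∀ a b, D (β a b) = β (D a) b + β a (D b)) (n : ℕ) (a b : V) :
    (D ^ n) (β a b) = ∑ ij ∈ Finset.HasAntidiagonal.antidiagonal n,
      n.choose ij.1 • β ((D ^ ij.1) a) ((D ^ ij.2) b) := by
  induction n with
  | zero => simp
  | succ n ih =>
    rw [Finset.sum_antidiagonal_choose_succ_nsmul
      (fun i j => β ((D ^ i) a) ((D ^ j) b)) n]
    simp only [pow_succ', Module.End.mul_apply, ih, map_sum, map_nsmul, hβ, nsmul_add,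
      Finset.sum_add_distrib]
    rw [add_comm, add_right_inj]
    refine Finset.sum_congr rfl fun ⟨i, j⟩ hij => ?_
    rw [n.choose_symm_of_eq_add (Finset.HasAntidiagonal.mem_antidiagonal.1 hij).symm]

theorem inv_factorial_smul_leibniz [CharZero K] {β : V →ₗ[K] V →ₗ[K] V}
    (hβ : ∀ a b, D (β a b) = β (D a) b + β a (D b)) (n : ℕ) (a b : V) :
    (n.factorial : K)⁻¹ • (D ^ n) (β a b) = ∑ ij ∈ Finset.HasAntidiagonal.antidiagonal n,
      β ((ij.1.factorial : K)⁻¹ • (D ^ ij.1) a) ((ij.2.factorial : K)⁻¹ • (D ^ ij.2) b) := by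
  rw [leibniz_pow_apply hβ, Finset.smul_sum]
  refine Finset.sum_congr rfl fun ⟨i, j⟩ hij => ?_
  obtain rfl := Finset.HasAntidiagonal.mem_antidiagonal.1 hij
  have hi : (i.factorial : K) ≠ 0 := by exact_mod_cast i.factorial_ne_zero
  have hj : (j.factorial : K) ≠ 0 := by exact_mod_cast j.factorial_ne_zero
  simp only [map_smul, LinearMap.smul_apply, ← Nat.cast_smul_eq_nsmul K, smul_smul]
  congr 1
  have h : (((i + j).choose i * i.factorial * j.factorial : ℕ) : K) = ((i + j).factorial : ℕ) :=
    congrArg _ (by rw [Nat.choose_symm_add, Nat.add_choose_mul_factorial_mul_factorial])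
  have hij : ((i + j).factorial : K) ≠ 0 := by exact_mod_cast (i + j).factorial_ne_zero
  push_cast at h
  field_simp
  rw [← h]
  ring

theorem expOp_bilinear [CharZero K] (hD : ∀ v, ∃ N, (D ^ N) v = 0) {β : V →ₗ[K] V →ₗ[K] V}
    (hβ : ∀ a b, D (β a b) = β (D a) b + β a (D b)) (a b : V) :
    expOp D (β a b) = β (expOp D a) (expOp D b) := by
  obtain ⟨N, hN⟩ := hD a
  obtain ⟨M, hM⟩ := hD b
  have ha : ∀ i, N ≤ i → (D ^ i) a = 0 := fun i hi => pow_apply_eq_zero_of_le hN hi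
  have hb : ∀ i, M ≤ i → (D ^ i) b = 0 := fun i hi => pow_apply_eq_zero_of_le hM hi
  have hout : ∀ p : ℕ × ℕ, p ∉ Finset.range N ×ˢ Finset.range M →
      β ((p.1.factorial : K)⁻¹ • (D ^ p.1) a) ((p.2.factorial : K)⁻¹ • (D ^ p.2) b) = 0 := by
    rintro ⟨i, j⟩ hp
    rw [Finset.mem_product, Finset.mem_range, Finset.mem_range, not_and_or, not_lt, not_lt] at hp
    rcases hp with hp | hp
    · simp [ha i hp]
    · simp [hb j hp]
  rw [expOp_eq_sum ha, expOp_eq_sum hb, expOp_eq_sum (N := N + M)]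
  · simp only [inv_factorial_smul_leibniz hβ, map_sum, LinearMap.sum_apply]
    rw [Finset.sum_comm, ← Finset.sum_product',
      ← Finset.sum_fiberwise_of_maps_to (t := Finset.range (N + M)) (g := fun p : ℕ × ℕ => p.1 + p.2)]
    · refine Finset.sum_congr rfl fun n _ => (Finset.sum_subset ?_ ?_).symm
      · intro p hp
        exact Finset.HasAntidiagonal.mem_antidiagonal.mpr (Finset.mem_filter.mp hp).2
      · intro p hp hp'
        refine hout p fun h => hp' (Finset.mem_filter.mpr ⟨h, Finset.HasAntidiagonal.mem_antidiagonal.mp hp⟩)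
    · intro p hp
      simp only [Finset.mem_product, Finset.mem_range] at hp ⊢
      omega
  · intro n hn
    rw [leibniz_pow_apply hβ]
    refine Finset.sum_eq_zero fun ⟨i, j⟩ hij => ?_
    have := Finset.HasAntidiagonal.mem_antidiagonal.mp hij
    rcases le_or_gt N i with h | h
    · simp [ha i h]
    · simp [hb j (by simp only at this; omega)]

end Exponential

namespace VA.IsVAHom

variable {K V : Type*} [Field K] [AddCommGroup V] [Module K V] {A : VA K V} {f : V → V}

/-- The underlying linear map of a vertex algebra homomorphism. -/
def toLin (hf : A.IsVAHom f) : V →ₗ[K] V where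
  toFun := f
  map_add' := hf.map_add
  map_smul' := hf.map_smul

theorem toLin_apply (hf : A.IsVAHom f) (v : V) : hf.toLin v = f v := rfl

theorem map_zero (hf : A.IsVAHom f) : f 0 = 0 := _root_.map_zero hf.toLin

theorem map_T (hf : A.IsVAHom f) (v : V) : f (A.T v) = A.T (f v) := by
  rw [A.T_apply, hf.map_ncoef, hf.map_vac, A.T_apply]

end VA.IsVAHom

namespace VA.IsVAAut

variable {K V : Type*} [Field K] [AddCommGroup V] [Module K V] {A : VA K V} {f g : V → V}

theorem comp (hf : A.IsVAAut f) (hg : A.IsVAAut g) : A.IsVAAut (f ∘ g) where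
  left := {
    map_add := fun a b => by simp only [Function.comp_apply, hf.1.map_add, hg.1.map_add]
    map_smul := fun c a => by simp only [Function.comp_apply, hf.1.map_smul, hg.1.map_smul]
    map_ncoef := fun n a b => by simp only [Function.comp_apply, hf.1.map_ncoef, hg.1.map_ncoef]
    map_vac := by simp only [Function.comp_apply, hf.1.map_vac, hg.1.map_vac] }
  right := hf.2.comp hg.2

theorem of_inverse (hf : A.IsVAAut f) (h₁ : ∀ v, g (f v) = v) (h₂ : ∀ v, f (g v) = v) :
    A.IsVAAut g where
  left := {
    map_add := fun a b => hf.2.1 (by rw [hf.1.map_add, h₂, h₂, h₂])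
    map_smul := fun c a => hf.2.1 (by rw [hf.1.map_smul, h₂, h₂])
    map_ncoef := fun n a b => hf.2.1 (by rw [hf.1.map_ncoef, h₂, h₂, h₂])
    map_vac := hf.2.1 (by rw [h₂, hf.1.map_vac]) }
  right := Function.bijective_iff_has_inverse.mpr ⟨f, h₂, h₁⟩

end VA.IsVAAut

namespace GradedVA

section Filtration

variable {K V : Type*} [Field K] [AddCommGroup V] [Module K V] {A : VA K V} (G : GradedVA A)

theorem hom_ext {f g : V → V} (hf : A.IsVAHom f) (hg : A.IsVAHom g)
    (h : ∀ n, ∀ v ∈ G.gr n, f v = g v) : f = g := by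
  funext v
  induction v using G.homogeneous_induction with
  | zero => rw [hf.map_zero, hg.map_zero]
  | homogeneous n v hv => exact h n v hv
  | add v w hv hw => rw [hf.map_add, hg.map_add, hv, hw]

theorem sub_prₗ_mem_ge {n : ℤ} {x : V} (hx : x ∈ G.ge n) : x - G.prₗ n x ∈ G.ge (n + 1) := by
  refine G.mem_ge_iff.mpr fun i hi => ?_
  rw [map_sub, sub_eq_zero]
  rcases eq_or_ne i n with rfl | h
  · rw [G.prₗ_same (G.prₗ_mem _ _)]
  · rw [G.mem_ge_iff.mp hx i (by omega), G.prₗ_ne (G.prₗ_mem n x) h.symm]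

theorem sub_prₗ_mem_le {n : ℤ} {x : V} (hx : x ∈ G.le n) : x - G.prₗ n x ∈ G.le (n - 1) := by
  refine G.mem_le_iff.mpr fun i hi => ?_
  rw [map_sub, sub_eq_zero]
  rcases eq_or_ne i n with rfl | h
  · rw [G.prₗ_same (G.prₗ_mem _ _)]
  · rw [G.mem_le_iff.mp hx i (by omega), G.prₗ_ne (G.prₗ_mem n x) h.symm]

/-- A linear map raising degrees preserves the decreasing filtration, and its leading part
depends only on the lowest component. -/
theorem map_ge {f : V →ₗ[K] V} (hf : ∀ n, ∀ v ∈ G.gr n, f v ∈ G.ge n) {n : ℤ} {x : V}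
    (hx : x ∈ G.ge n) : f x ∈ G.ge n ∧ G.prₗ n (f x) = G.prₗ n (f (G.prₗ n x)) := by
  have h : ∀ n, ∀ x ∈ G.ge n, f x ∈ G.ge n := fun n x hx =>
    G.ge_induction (p := fun x => f x ∈ G.ge n) (by simp)
      (fun i hi v hv => G.ge_anti hi (hf i v hv))
      (fun v w hv hw => by rw [map_add]; exact add_mem hv hw) hx
  refine ⟨h n x hx, ?_⟩
  rw [← sub_eq_zero, ← map_sub, ← map_sub]
  exact G.mem_ge_iff.mp (h _ _ (G.sub_prₗ_mem_ge hx)) n (by omega)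

theorem map_le {f : V →ₗ[K] V} (hf : ∀ n, ∀ v ∈ G.gr n, f v ∈ G.le n) {n : ℤ} {x : V}
    (hx : x ∈ G.le n) : f x ∈ G.le n ∧ G.prₗ n (f x) = G.prₗ n (f (G.prₗ n x)) := by
  have h : ∀ n, ∀ x ∈ G.le n, f x ∈ G.le n := fun n x hx => by
    obtain ⟨s, -, hs⟩ := G.exists_finset_sum_prₗ x
    rw [← hs, map_sum]
    refine sum_mem fun i _ => ?_
    rcases le_or_gt i n with hi | hi
    · exact G.le_mono hi (hf i _ (G.prₗ_mem i x))
    · rw [G.mem_le_iff.mp hx i hi, map_zero]; exact zero_mem _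
  refine ⟨h n x hx, ?_⟩
  rw [← sub_eq_zero, ← map_sub, ← map_sub]
  exact G.mem_le_iff.mp (h _ _ (G.sub_prₗ_mem_le hx)) n (by omega)

/-- A degree-raising map with injective leading part reflects the decreasing filtration. -/
theorem mem_ge_of_map_mem_ge {f : V →ₗ[K] V} (hf : ∀ n, ∀ v ∈ G.gr n, f v ∈ G.ge n)
    (hf' : ∀ n, ∀ v ∈ G.gr n, G.prₗ n (f v) = 0 → v = 0) {n : ℤ} {x : V} (hx : f x ∈ G.ge n) :
    x ∈ G.ge n := by
  rcases eq_or_ne x 0 with rfl | h0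
  · exact zero_mem _
  obtain ⟨m, hm, hlow⟩ := G.exists_lowest h0
  have h := G.map_ge hf (G.mem_ge_iff.mpr hlow)
  refine G.ge_anti ?_ (G.mem_ge_iff.mpr hlow)
  by_contra hc
  refine hm (hf' m _ (G.prₗ_mem m x) ?_)
  rw [← h.2]
  exact G.mem_ge_iff.mp hx m (by omega)

theorem mem_le_of_map_mem_le {f : V →ₗ[K] V} (hf : ∀ n, ∀ v ∈ G.gr n, f v ∈ G.le n)
    (hf' : ∀ n, ∀ v ∈ G.gr n, G.prₗ n (f v) = 0 → v = 0) {n : ℤ} {x : V} (hx : f x ∈ G.le n) :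
    x ∈ G.le n := by
  rcases eq_or_ne x 0 with rfl | h0
  · exact zero_mem _
  obtain ⟨m, hm, hhigh⟩ := G.exists_highest h0
  have h := G.map_le hf (G.mem_le_iff.mpr hhigh)
  refine G.le_mono ?_ (G.mem_le_iff.mpr hhigh)
  by_contra hc
  refine hm (hf' m _ (G.prₗ_mem m x) ?_)
  rw [← h.2]
  exact G.mem_le_iff.mp hx m (by omega)

/-- The degree-preserving part `v ↦ ∑ₙ pr_n f (pr_n v)` of a linear map. -/
def diag (f : V →ₗ[K] V) : V →ₗ[K] V :=
  letI := G.decomp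
  DirectSum.toModule K ℤ V (fun n => G.prₗ n ∘ₗ f ∘ₗ (G.gr n).subtype) ∘ₗ
    (DirectSum.decomposeLinearEquiv G.gr).toLinearMap

theorem diag_apply {f : V →ₗ[K] V} {n : ℤ} {v : V} (hv : v ∈ G.gr n) :
    G.diag f v = G.prₗ n (f v) := by
  let _ := G.decomp
  lift v to G.gr n using hv
  simp [diag]

theorem diag_mem {f : V →ₗ[K] V} {n : ℤ} {v : V} (hv : v ∈ G.gr n) : G.diag f v ∈ G.gr n := by
  rw [G.diag_apply hv]; exact G.prₗ_mem n _

theorem diag_isVAHom {f : V → V} (hf : A.IsVAHom f) (hge : ∀ n, ∀ v ∈ G.gr n, f v ∈ G.ge n) :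
    A.IsVAHom (G.diag hf.toLin) where
  map_add := map_add _
  map_smul := map_smul _
  map_vac := by
    rw [G.diag_apply G.vac_mem, hf.toLin_apply, hf.map_vac, G.prₗ_same G.vac_mem]
  map_ncoef n a b := by
    induction a using G.homogeneous_induction with
    | zero => simp
    | add a a' ha ha' => simp only [map_add, LinearMap.add_apply, ha, ha']
    | homogeneous i a ha =>
      induction b using G.homogeneous_induction with
      | zero => simp
      | add b b' hb hb' => simp only [map_add, hb, hb']
      | homogeneous j b hb =>
        rw [G.diag_apply (G.ncoef_mem i j n a ha b hb), G.diag_apply ha, G.diag_apply hb,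
          hf.toLin_apply, hf.toLin_apply, hf.toLin_apply, hf.map_ncoef,
          (G.ncoef_mem_ge (hge i a ha) (hge j b hb)).2]

end Filtration

end GradedVA

namespace VOAsCFT

section ConformalVectors

variable {K V : Type*} [Field K] [AddCommGroup V] [Module K V] {A : VA K V}
  (W : VOAsCFT A)

theorem pow_ncoef_one_mem {c : V} (hc : c ∈ W.gr 1) {n : ℤ} {v : V} (hv : v ∈ W.gr n) (i : ℕ) :
    (A.ncoef 1 c ^ i) v ∈ W.gr (n - i) := by
  induction i with
  | zero => simpa using hv
  | succ i ih =>
    rw [pow_succ', Module.End.mul_apply]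
    have := W.ncoef_mem _ _ 1 c hc _ ih
    convert this using 2
    push_cast; ring

theorem ncoef_one_locally_nilpotent {c : V} (hc : c ∈ W.gr 1) (v : V) :
    ∃ N, (A.ncoef 1 c ^ N) v = 0 := by
  induction v using W.homogeneous_induction with
  | zero => exact ⟨0, map_zero _⟩
  | homogeneous n v hv =>
    exact ⟨n.toNat + 1, W.eq_zero_of_mem_neg (by omega) (W.pow_ncoef_one_mem hc hv _)⟩
  | add v w hv hw =>
    obtain ⟨N, hN⟩ := hv
    obtain ⟨M, hM⟩ := hw
    exact ⟨max N M, by rw [map_add, pow_apply_eq_zero_of_le hN (le_max_left _ _),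
      pow_apply_eq_zero_of_le hM (le_max_right _ _), add_zero]⟩

theorem expOp_sub_mem_le {c : V} (hc : c ∈ W.gr 1) {n : ℤ} {v : V} (hv : v ∈ W.gr n) :
    expOp (A.ncoef 1 c) v - v - A.ncoef 1 c v ∈ W.le (n - 2) := by
  obtain ⟨N, hN⟩ := W.ncoef_one_locally_nilpotent hc v
  rw [expOp_eq_sum (N := N + 2) fun i hi => pow_apply_eq_zero_of_le hN (by omega),
    Finset.sum_range_succ', Finset.sum_range_succ']
  simp only [zero_add, pow_one, pow_zero, Nat.factorial_one, Nat.factorial_zero, Nat.cast_one,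
    inv_one, one_smul, Module.End.one_apply]
  rw [add_sub_cancel_right, add_sub_cancel_right]
  exact sum_mem fun i _ => Submodule.smul_mem _ _
    (W.le_mono (by push_cast; omega) (W.mem_le_of_mem (W.pow_ncoef_one_mem hc hv _)))

/-- A degree-lowering linear map with identity leading part is bijective. -/
theorem bijective_of_map_le {g : V →ₗ[K] V}
    (hg : ∀ n, ∀ v ∈ W.gr n, g v ∈ W.le n ∧ W.prₗ n (g v) = v) : Function.Bijective g := by
  constructor
  · rw [← LinearMap.ker_eq_bot, LinearMap.ker_eq_bot']
    intro x hx
    refine W.eq_zero_of_prₗ fun n => ?_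
    rcases lt_or_ge n 0 with hn | hn
    · exact W.prₗ_neg hn x
    refine W.mem_le_iff.mp (W.mem_le_of_map_mem_le (fun n v hv => (hg n v hv).1)
      (fun n v hv h => by rw [← (hg n v hv).2, h]) (n := -1) (x := x) ?_) n (by omega)
    rw [hx]
    exact zero_mem _
  · have h : ∀ (r : ℕ), ∀ x ∈ W.le ((r : ℤ) - 1), ∃ y, g y = x := by
      intro r
      induction r with
      | zero =>
        intro x hx
        refine ⟨0, ?_⟩
        rw [map_zero, eq_comm]
        refine W.eq_zero_of_prₗ fun n => ?_
        rcases lt_or_ge n 0 with hn | hn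
        · exact W.prₗ_neg hn x
        · exact W.mem_le_iff.mp hx n (by push_cast; omega)
      | succ r ih =>
        intro x hx
        rw [show (((r + 1 : ℕ) : ℤ) - 1) = r by push_cast; ring] at hx
        have hgx := hg r _ (W.prₗ_mem r x)
        have h₁ := W.sub_prₗ_mem_le hx
        have h₂ := W.sub_prₗ_mem_le hgx.1
        rw [hgx.2] at h₂
        obtain ⟨y, hy⟩ := ih _ (sub_mem h₁ h₂)
        exact ⟨y + W.prₗ r x, by rw [map_add, hy]; abel⟩
    intro x
    rcases eq_or_ne x 0 with rfl | hx
    · exact ⟨0, map_zero _⟩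
    obtain ⟨m, -, hm⟩ := W.exists_highest hx
    refine h (m + 1).toNat x (W.mem_le_iff.mpr fun i hi => hm i (by omega))

theorem expOp_autMinus [CharZero K] {c : V} (hc : c ∈ W.J1) :
    W.AutMinus (expOp (A.ncoef 1 c)) := by
  have hD := W.ncoef_one_locally_nilpotent hc.1
  have hhom : A.IsVAHom (expOp (A.ncoef 1 c)) := {
    map_add := expOp_add hD
    map_smul := expOp_smul
    map_ncoef := fun n => expOp_bilinear hD fun a b => by
      have := A.commutator_one c a b n
      rw [hc.2, LinearMap.zero_apply, map_zero, LinearMap.zero_apply, zero_add] at this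
      rw [← this, sub_add_cancel]
    map_vac := expOp_of_eq_zero (A.ncoef_vac_zero 1 (by decide) c) }
  have hlead : ∀ n, ∀ v ∈ W.gr n, expOp (A.ncoef 1 c) v ∈ W.le n ∧
      W.prₗ n (expOp (A.ncoef 1 c) v) = v := by
    intro n v hv
    have h₁ := W.expOp_sub_mem_le hc.1 hv
    have h₂ : A.ncoef 1 c v ∈ W.le (n - 1) := by
      simpa using W.mem_le_of_mem (W.pow_ncoef_one_mem hc.1 hv 1)
    have h₃ : expOp (A.ncoef 1 c) v - v ∈ W.le (n - 1) := by
      have := add_mem (W.le_mono (by omega) h₁) h₂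
      rwa [sub_add_cancel] at this
    refine ⟨?_, ?_⟩
    · have := add_mem (W.le_mono (by omega) h₃) (W.mem_le_of_mem hv)
      rwa [sub_add_cancel] at this
    · have := W.mem_le_iff.mp h₃ n (by omega)
      rwa [map_sub, W.prₗ_same hv, sub_eq_zero] at this
  exact ⟨⟨hhom, W.bijective_of_map_le (g := hhom.toLin) hlead⟩, hlead⟩

theorem ncoef_zero_map_ω {f : V → V} (hf : A.IsVAAut f) : A.ncoef 0 (f W.ω) = A.T := by
  ext x
  obtain ⟨y, rfl⟩ := hf.2.2 x
  rw [← hf.1.map_ncoef, W.Lneg1_eq_T, hf.1.map_T]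

theorem ncoef_zero_prₗ {d : V} (hd : A.ncoef 0 d = 0) (i : ℤ) : A.ncoef 0 (W.prₗ i d) = 0 := by
  ext u
  induction u using W.homogeneous_induction with
  | zero => simp
  | add u v hu hv => rw [map_add, hu, hv]; simp
  | homogeneous j u hu =>
    rw [← W.prₗ_ncoef_left hu, hd]
    simp

theorem prₗ_one_map_ω_mem_J1 {f : V → V} (hf : A.IsVAAut f) : W.prₗ 1 (f W.ω) ∈ W.J1 := by
  have h : W.prₗ 1 (f W.ω) = W.prₗ 1 (f W.ω - W.ω) := by
    rw [map_sub, W.prₗ_ne W.ω_mem (by decide), sub_zero]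
  refine ⟨W.prₗ_mem 1 _, ?_⟩
  rw [h]
  refine W.ncoef_zero_prₗ ?_ 1
  rw [map_sub, W.ncoef_zero_map_ω hf, W.Lneg1_eq_T, sub_self]

theorem ncoef_map_ω_leading {f : V → V} (h₁ : W.prₗ 1 (f W.ω) = 0) {m k : ℤ}
    (hk : k ≠ -1) {x : V} (hx : x ∈ W.ge m) :
    W.prₗ (2 + m - k - 1) (A.ncoef k (f W.ω) x) =
      A.ncoef k (W.prₗ 2 (f W.ω)) (W.prₗ m x) := by
  have hge : f W.ω - W.prₗ 0 (f W.ω) ∈ W.ge 2 := by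
    refine W.mem_ge_iff.mpr fun i hi => ?_
    rw [map_sub]
    rcases eq_or_ne i 0 with rfl | hi0
    · rw [W.prₗ_same (W.prₗ_mem 0 _), sub_self]
    rw [W.prₗ_ne (W.prₗ_mem 0 _) hi0.symm, sub_zero]
    rcases eq_or_ne i 1 with rfl | hi1
    · exact h₁
    · exact W.prₗ_neg (by omega) _
  have h := (W.ncoef_mem_ge (k := k) hge hx).2
  rwa [map_sub, LinearMap.sub_apply,
    W.ncoef_left_eq_zero_of_mem_gr_zero (W.prₗ_mem 0 _) x hk, sub_zero, map_sub,
    W.prₗ_ne (W.prₗ_mem 0 (f W.ω)) (by decide), sub_zero] at h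

variable [CharZero K]

/-- The image of `ω` under an automorphism, up to components of degree at most one and
translates. -/
theorem exists_prₗ_map_ω {f : V → V} (hf : A.IsVAAut f) (i : ℤ) (hi : 2 ≤ i) :
    ∃ b ∈ W.gr (i - 1), W.prₗ i (f W.ω) = W.prₗ i W.ω + A.T b := by
  have hd : A.ncoef 0 (f W.ω - W.ω) = 0 := by
    rw [map_sub, W.ncoef_zero_map_ω hf, W.Lneg1_eq_T, sub_self]
  obtain ⟨b, hb, h⟩ := W.exists_T_eq hi (W.prₗ_mem i _) (W.ncoef_zero_prₗ hd i)
  exact ⟨b, hb, by rw [h, map_sub, add_sub_cancel]⟩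

/-- The action of `exp c(1)`, `c ∈ J_1(V)`, on the degree one component of the image of `ω`. -/
theorem prₗ_one_expOp_map_ω {f : V → V} (hf : A.IsVAAut f) {c : V} (hc : c ∈ W.J1) :
    W.prₗ 1 (expOp (A.ncoef 1 c) (f W.ω)) = W.prₗ 1 (f W.ω) + c := by
  obtain ⟨⟨hE, -⟩, hE'⟩ := W.expOp_autMinus hc
  set E := expOp (A.ncoef 1 c) with hEdef
  obtain ⟨s, hs, hsum⟩ := W.exists_finset_sum_prₗ (f W.ω)
  have h : ∀ i, W.prₗ 1 (E (W.prₗ i (f W.ω))) =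
      if i = 1 then W.prₗ 1 (f W.ω) else if i = 2 then c else 0 := by
    intro i
    rcases lt_or_ge i 1 with hi | hi
    · rw [if_neg (by omega), if_neg (by omega)]
      exact W.mem_le_iff.mp (hE' i _ (W.prₗ_mem i _)).1 1 hi
    rcases eq_or_lt_of_le hi with rfl | hi
    · rw [if_pos rfl]
      exact (hE' 1 _ (W.prₗ_mem 1 _)).2
    rw [if_neg (by omega)]
    obtain ⟨b, -, hb⟩ := W.exists_prₗ_map_ω hf i (by omega)
    have hT : W.prₗ 1 (A.T (E b)) = 0 := by
      rw [show (1 : ℤ) = 0 + 1 by rfl, W.prₗ_T]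
      exact W.T_eq_zero_of_mem_gr_zero (W.prₗ_mem 0 _)
    rw [hb, hE.map_add, hE.map_T, map_add, hT, add_zero]
    split_ifs with h2
    · subst h2
      have h₁ := W.mem_le_iff.mp (W.expOp_sub_mem_le hc.1 W.ω_mem) 1 (by decide)
      rw [W.ncoef_one_ω hc.1, map_sub, map_sub, W.prₗ_ne W.ω_mem (by decide), sub_zero,
        W.prₗ_same hc.1, sub_eq_zero] at h₁
      rw [W.prₗ_same W.ω_mem]
      exact h₁
    · rw [W.prₗ_ne W.ω_mem (Ne.symm h2), hE.map_zero, map_zero]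
  have h₂ : (2 : ℤ) ∈ s ∨ c = 0 := by
    by_contra hcon
    rw [not_or] at hcon
    have := h 2
    rw [hs 2 hcon.1, hE.map_zero, map_zero, if_neg (by decide), if_pos rfl] at this
    exact hcon.2 this.symm
  have h₁ : (1 : ℤ) ∈ s ∨ W.prₗ 1 (f W.ω) = 0 := by
    by_contra hcon
    rw [not_or] at hcon
    exact hcon.2 (hs 1 hcon.1)
  have hlin : E (f W.ω) = ∑ i ∈ s, E (W.prₗ i (f W.ω)) := by
    conv_lhs => rw [← hsum]
    exact map_sum hE.toLin _ _
  rw [hlin, map_sum, Finset.sum_congr rfl fun i _ => h i]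
  have hsplit : ∀ i : ℤ, (if i = 1 then W.prₗ 1 (f W.ω) else if i = 2 then c else 0) =
      (if i = 1 then W.prₗ 1 (f W.ω) else 0) + (if i = 2 then c else 0) := by
    intro i
    split_ifs with h₁ h₂
    · omega
    all_goals simp
  rw [Finset.sum_congr rfl fun i _ => hsplit i, Finset.sum_add_distrib, Finset.sum_ite_eq',
    Finset.sum_ite_eq']
  congr 1
  · split_ifs with h
    · rfl
    · exact (h₁.resolve_left h).symm
  · split_ifs with h
    · rfl
    · exact (h₂.resolve_left h).symm

section NoLinearTerm

variable {f : V → V}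

/-- In a simple vertex operator algebra, a conformal vector without linear term has the same
degree two component as `ω`. -/
theorem prₗ_two_map_ω (hs : A.IsSimple) (hf : A.IsVAAut f) (h₁ : W.prₗ 1 (f W.ω) = 0) :
    W.prₗ 2 (f W.ω) = W.ω := by
  obtain ⟨b, hb, hab⟩ := W.exists_prₗ_map_ω hf 2 le_rfl
  rw [W.prₗ_same W.ω_mem] at hab
  rw [show (2 : ℤ) - 1 = 1 by rfl] at hb
  have hL0 : ∀ {m : ℤ} {x : V}, x ∈ W.ge m →
      W.prₗ m (A.ncoef 1 (f W.ω) x) = (m : K) • W.prₗ m x - A.ncoef 0 b (W.prₗ m x) := by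
    intro m x hx
    have h := W.ncoef_map_ω_leading h₁ (k := 1) (by decide) hx
    rw [show 2 + m - 1 - 1 = m by ring, hab, map_add, LinearMap.add_apply,
      W.L0_grading m _ (W.prₗ_mem m x), A.ncoef_T] at h
    rw [h]
    simp [sub_eq_add_neg]
  have heig : ∀ {j : ℤ} {w : V}, w ∈ W.gr j → A.ncoef 1 (f W.ω) (f w) = (j : K) • f w := by
    intro j w hw
    rw [← hf.1.map_ncoef, W.L0_grading j w hw, hf.1.map_smul]
  have hge1 : ∀ {j : ℤ} {w : V}, 1 ≤ j → w ∈ W.gr j → f w ∈ W.ge 1 := by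
    intro j w hj hw
    refine W.mem_ge_iff.mpr fun i hi => ?_
    rcases eq_or_ne i 0 with rfl | hi0
    · have h := hL0 (W.mem_ge_zero (f w))
      rw [heig hw, W.ncoef_eq_zero_of_mem_gr_zero (W.prₗ_mem 0 _) b le_rfl, Int.cast_zero,
        zero_smul, sub_zero, map_smul, smul_eq_zero] at h
      exact h.resolve_left (by exact_mod_cast (by omega : j ≠ 0))
    · exact W.prₗ_neg (by omega) _
  have hD : ∀ {j : ℤ} {w : V}, 1 ≤ j → w ∈ W.gr j →
      A.ncoef 0 b (W.prₗ 1 (f w)) = (1 - j : K) • W.prₗ 1 (f w) := by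
    intro j w hj hw
    have h := hL0 (hge1 hj hw)
    rw [heig hw, map_smul, Int.cast_one, one_smul] at h
    rw [sub_smul, one_smul, h, sub_sub_cancel]
  -- the action of `f` on the degree zero part
  have hzero : ∀ {w : V}, w ∈ W.gr 0 → W.prₗ 1 (f w) = 0 := by
    intro w hw
    obtain ⟨c, rfl⟩ := W.exists_eq_smul_vac hw
    rw [hf.1.map_smul, hf.1.map_vac, map_smul, W.prₗ_ne W.vac_mem (by decide), smul_zero]
  -- a property of `V_1` may be tested on the degree one components of the images of `V_j`
  have hV1 : ∀ x : V, (∀ j, 1 ≤ j → ∀ w ∈ W.gr j, A.ncoef 1 x (W.prₗ 1 (f w)) = 0) →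
      ∀ y ∈ W.gr 1, A.ncoef 1 x y = 0 := by
    intro x hx y hy
    obtain ⟨w, rfl⟩ := hf.2.2 y
    rw [← W.prₗ_same hy]
    clear hy
    induction w using W.homogeneous_induction with
    | zero => rw [hf.1.map_zero, map_zero, map_zero]
    | add v w hv hw => rw [hf.1.map_add, map_add, map_add, hv, hw, add_zero]
    | homogeneous j w hw =>
      rcases lt_trichotomy j 0 with hj | rfl | hj
      · rw [W.eq_zero_of_mem_neg hj hw, hf.1.map_zero, map_zero, map_zero]
      · rw [hzero hw, map_zero]
      · exact hx j (by omega) w hw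
  have hi2 : ∀ {i : ℤ} {u : V}, 2 ≤ i → u ∈ W.gr i → W.prₗ 1 (f u) = 0 := by
    intro i u hi hu
    refine W.eq_zero_of_radical hs (W.prₗ_mem 1 _) (hV1 _ fun j hj w hw => ?_)
    have h := A.commutator_zero b (W.prₗ 1 (f u)) (W.prₗ 1 (f w)) 1
    have h0 : A.ncoef 1 (W.prₗ 1 (f u)) (W.prₗ 1 (f w)) ∈ W.gr 0 :=
      W.ncoef_mem 1 1 1 _ (W.prₗ_mem 1 _) _ (W.prₗ_mem 1 _)
    rw [W.ncoef_eq_zero_of_mem_gr_zero h0 b le_rfl, hD (by omega) hu, hD hj hw, map_smul,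
      map_smul, LinearMap.smul_apply, zero_sub, eq_comm, eq_neg_iff_add_eq_zero, ← add_smul,
      smul_eq_zero] at h
    refine h.resolve_left ?_
    intro hij
    have : ((1 - i + (1 - j) : ℤ) : K) = 0 := by push_cast; exact hij
    rw [Int.cast_eq_zero] at this
    omega
  have hb0 : b = 0 := by
    refine W.eq_zero_of_radical hs hb (hV1 _ fun j hj w hw => ?_)
    rcases eq_or_lt_of_le hj with rfl | hj
    · have h := W.ncoef_map_ω_leading h₁ (k := 2) (by decide) (hge1 le_rfl hw)
      rw [← hf.1.map_ncoef, W.L1_V1 w hw, hf.1.map_zero, map_zero, hab, map_add,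
        LinearMap.add_apply, W.L1_V1 _ (W.prₗ_mem 1 _), A.ncoef_T, zero_add, eq_comm,
        smul_eq_zero] at h
      exact h.resolve_left (by norm_num)
    · rw [hi2 (by omega) hw, map_zero]
  rw [hab, hb0, map_zero, add_zero]

theorem map_mem_ge (hs : A.IsSimple) (hf : A.IsVAAut f) (h₁ : W.prₗ 1 (f W.ω) = 0) {n : ℤ}
    {v : V} (hv : v ∈ W.gr n) : f v ∈ W.ge n ∧ (W.prₗ n (f v) = 0 → v = 0) := by
  rcases eq_or_ne v 0 with rfl | hv0
  · rw [hf.1.map_zero]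
    exact ⟨zero_mem _, fun _ => rfl⟩
  have hfv : f v ≠ 0 := fun h => hv0 (hf.2.1 (h.trans hf.1.map_zero.symm))
  obtain ⟨m, hm, hlow⟩ := W.exists_lowest hfv
  have hge := W.mem_ge_iff.mpr hlow
  have h := W.ncoef_map_ω_leading h₁ (k := 1) (by decide) hge
  rw [show 2 + m - 1 - 1 = m by ring, W.prₗ_two_map_ω hs hf h₁,
    W.L0_grading m _ (W.prₗ_mem m _), ← hf.1.map_ncoef, W.L0_grading n v hv, hf.1.map_smul,
    map_smul] at h
  have hnm : n = m := by exact_mod_cast smul_left_injective K hm h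
  subst hnm
  exact ⟨hge, fun h => absurd h hm⟩

end NoLinearTerm

end ConformalVectors

section Decomposition

variable {K V : Type*} [Field K] [AddCommGroup V] [Module K V] {A : VA K V}
  (W : VOAsCFT A)

/-- An automorphism preserving the decreasing filtration with injective leading part is the
product of its leading part and an element of `Aut⁺V`. -/
theorem exists_autZero_comp_autPlus {f : V → V} (hf : A.IsVAAut f)
    (hge : ∀ n, ∀ v ∈ W.gr n, f v ∈ W.ge n)
    (hinj : ∀ n, ∀ v ∈ W.gr n, W.prₗ n (f v) = 0 → v = 0) :
    ∃ h k : V → V, W.AutZero h ∧ W.AutPlus k ∧ f = h ∘ k := by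
  set h := W.diag hf.1.toLin with hdef
  have hh : ∀ {n : ℤ} {v : V}, v ∈ W.gr n → h v = W.prₗ n (f v) := fun hv => W.diag_apply hv
  have hmem : ∀ {n : ℤ} {v : V}, v ∈ W.gr n → h v ∈ W.gr n := fun hv => W.diag_mem hv
  have hpr : ∀ (n : ℤ) (v : V), W.prₗ n (h v) = h (W.prₗ n v) := by
    intro n v
    induction v using W.homogeneous_induction with
    | zero => simp
    | add v w hv hw => simp only [map_add, hv, hw]
    | homogeneous m v hv =>
      rcases eq_or_ne m n with rfl | hmn
      · rw [W.prₗ_same hv, W.prₗ_same (hmem hv)]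
      · rw [W.prₗ_ne hv hmn, W.prₗ_ne (hmem hv) hmn, map_zero]
  have hhinj : Function.Injective h := by
    rw [← LinearMap.ker_eq_bot, LinearMap.ker_eq_bot']
    intro v hv
    refine W.eq_zero_of_prₗ fun n => hinj n _ (W.prₗ_mem n v) ?_
    rw [← hh (W.prₗ_mem n v), ← hpr, hv, map_zero]
  have hhsurj : Function.Surjective h := by
    rw [← LinearMap.range_eq_top, eq_top_iff]
    intro v _
    induction v using W.homogeneous_induction with
    | zero => exact zero_mem _
    | add v w hv hw => exact add_mem (hv trivial) (hw trivial)
    | homogeneous n v hv =>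
      obtain ⟨y, rfl⟩ := hf.2.2 v
      have hy : y ∈ W.ge n :=
        W.mem_ge_of_map_mem_ge (f := hf.1.toLin) hge hinj (W.mem_ge_of_mem hv)
      refine ⟨W.prₗ n y, ?_⟩
      rw [hh (W.prₗ_mem n y), ← W.prₗ_same hv]
      exact (W.map_ge (f := hf.1.toLin) hge hy).2.symm
  have haut : A.IsVAAut h := ⟨W.diag_isVAHom hf.1 hge, hhinj, hhsurj⟩
  obtain ⟨g, hgl, hgr⟩ := Function.bijective_iff_has_inverse.mp haut.2
  refine ⟨h, g ∘ f, ⟨haut, fun n v hv => hmem hv⟩,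
    ⟨(haut.of_inverse hgl hgr).comp hf, fun n v hv => ⟨?_, ?_⟩⟩, ?_⟩
  · refine W.mem_ge_iff.mpr fun i hi => hhinj ?_
    rw [← hpr, Function.comp_apply, hgr, map_zero]
    exact W.mem_ge_iff.mp (hge n v hv) i hi
  · refine hhinj ?_
    change h (W.prₗ n (g (f v))) = h v
    rw [← hpr, hgr, hh hv]
  · funext v
    exact (hgr (f v)).symm

theorem exists_decomposition [CharZero K] (hs : A.IsSimple) {f : V → V} (hf : A.IsVAAut f) :
    ∃ c ∈ W.J1, ∃ h k : V → V, W.AutZero h ∧ W.AutPlus k ∧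
      f = expOp (A.ncoef 1 c) ∘ h ∘ k := by
  have hc := W.prₗ_one_map_ω_mem_J1 hf
  obtain ⟨hE, -⟩ := W.expOp_autMinus hc
  obtain ⟨E', hl, hr⟩ := Function.bijective_iff_has_inverse.mp hE.2
  have hf' : A.IsVAAut (E' ∘ f) := (hE.of_inverse hl hr).comp hf
  have h₁ : W.prₗ 1 ((E' ∘ f) W.ω) = 0 := by
    have h := W.prₗ_one_expOp_map_ω hf' hc
    rwa [Function.comp_apply, hr, right_eq_add] at h
  obtain ⟨h, k, hh, hk, hhk⟩ := W.exists_autZero_comp_autPlus hf'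
    (fun n v hv => (W.map_mem_ge hs hf' h₁ hv).1) (fun n v hv => (W.map_mem_ge hs hf' h₁ hv).2)
  refine ⟨_, hc, h, k, hh, hk, ?_⟩
  rw [← hhk]
  funext v
  exact (hr (f v)).symm

theorem comp_leading {h k : V → V} (hh : W.AutZero h) (hk : W.AutPlus k) {n : ℤ} {v : V}
    (hv : v ∈ W.gr n) : h (k v) ∈ W.ge n ∧ W.prₗ n (h (k v)) = h v := by
  have h₁ := W.map_ge (f := hh.1.1.toLin) (fun n v hv => W.mem_ge_of_mem (hh.2 n v hv))
    (hk.2 n v hv).1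
  refine ⟨h₁.1, h₁.2.trans ?_⟩
  rw [W.prₗ_apply, W.prₗ_apply, (hk.2 n v hv).2]
  exact W.prₗ_same (hh.2 n v hv)

theorem comp_leading_injective {h k : V → V} (hh : W.AutZero h) (hk : W.AutPlus k) {n : ℤ} {v : V}
    (hv : v ∈ W.gr n) (h0 : W.prₗ n (h (k v)) = 0) : v = 0 := by
  rw [(W.comp_leading hh hk hv).2] at h0
  exact hh.1.2.1 (h0.trans hh.1.1.map_zero.symm)

theorem comp_unique {h k h' k' : V → V} (hh : W.AutZero h) (hk : W.AutPlus k)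
    (hh' : W.AutZero h') (hk' : W.AutPlus k') (heq : h ∘ k = h' ∘ k') : h = h' ∧ k = k' := by
  have e : h = h' := W.hom_ext hh.1.1 hh'.1.1 fun n v hv => by
    rw [← (W.comp_leading hh hk hv).2, ← (W.comp_leading hh' hk' hv).2]
    exact congrArg _ (congrFun heq v)
  subst e
  exact ⟨rfl, funext fun v => hh.1.2.1 (congrFun heq v)⟩

theorem decomposition_unique {g h k g' h' k' : V → V} (hg : W.AutMinus g) (hh : W.AutZero h)
    (hk : W.AutPlus k) (hg' : W.AutMinus g') (hh' : W.AutZero h') (hk' : W.AutPlus k')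
    (heq : g ∘ h ∘ k = g' ∘ h' ∘ k') : g = g' ∧ h = h' ∧ k = k' := by
  have e : g = g' := W.hom_ext hg.1.1 hg'.1.1 fun n v hv => by
    obtain ⟨y, rfl⟩ := (hh.1.comp hk.1).2.2 v
    have hy : y ∈ W.ge n := W.mem_ge_of_map_mem_ge (f := (hh.1.comp hk.1).1.toLin)
      (fun n v hv => (W.comp_leading hh hk hv).1) (fun n v => W.comp_leading_injective hh hk)
      (W.mem_ge_of_mem hv)
    have heqy : g ((h ∘ k) y) = g' ((h' ∘ k') y) := congrFun heq y
    have hx : (h' ∘ k') y ∈ W.ge n := (W.map_ge (f := (hh'.1.comp hk'.1).1.toLin)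
      (fun n v hv => (W.comp_leading hh' hk' hv).1) hy).1
    have hgle := hg.2 n _ hv
    rw [heqy] at hgle
    have hx' : (h' ∘ k') y ∈ W.le n := W.mem_le_of_map_mem_le (f := hg'.1.1.toLin)
      (fun n v hv => (hg'.2 n v hv).1)
      (fun n v hv h0 => (hg'.2 n v hv).2.symm.trans h0) hgle.1
    have hx₀ := W.mem_gr_of_mem_ge_of_mem_le hx hx'
    rw [heqy, ← hgle.2, (hg'.2 n _ hx₀).2]
  subst e
  refine ⟨rfl, W.comp_unique hh hk hh' hk' (funext fun v => hg.1.2.1 (congrFun heq v))⟩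

/-- Conjugating `Aut⁺V` by an element of `Aut⁰V ⋅ Aut⁺V` preserves it. -/
theorem autPlus_conj {f g k h k₁ : V → V} (hg : A.IsVAAut g)
    (hfg : ∀ v, f (g v) = v) (hh : W.AutZero h) (hk₁ : W.AutPlus k₁) (hf : f = h ∘ k₁)
    (hk : W.AutPlus k) : W.AutPlus (f ∘ k ∘ g) := by
  have hfa : A.IsVAAut f := hf ▸ hh.1.comp hk₁.1
  have hge : ∀ n, ∀ v ∈ W.gr n, hfa.1.toLin v ∈ W.ge n := fun n v hv => by
    rw [hfa.1.toLin_apply, hf]; exact (W.comp_leading hh hk₁ hv).1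
  have hinj : ∀ n, ∀ v ∈ W.gr n, W.prₗ n (hfa.1.toLin v) = 0 → v = 0 := fun n v hv h0 => by
    rw [hfa.1.toLin_apply, hf] at h0; exact W.comp_leading_injective hh hk₁ hv h0
  refine ⟨hfa.comp (hk.1.comp hg), fun n v hv => ?_⟩
  have hy : g v ∈ W.ge n := W.mem_ge_of_map_mem_ge hge hinj
    (by rw [hfa.1.toLin_apply, hfg]; exact W.mem_ge_of_mem hv)
  have hky := W.map_ge (f := hk.1.1.toLin) (fun n v hv => (hk.2 n v hv).1) hy
  have hfky := W.map_ge hge hky.1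
  refine ⟨hfky.1, hfky.2.trans ?_⟩
  have e : W.prₗ n (hk.1.1.toLin (W.prₗ n (g v))) = W.prₗ n (g v) :=
    (hk.2 n _ (W.prₗ_mem n (g v))).2
  rw [hky.2, e, ← (W.map_ge hge hy).2, hfa.1.toLin_apply, hfg, W.prₗ_same hv]

end Decomposition

end VOAsCFT

/-- Theorem `grp`: for a simple VOA of strong CFT type,
`Aut V = Aut⁻V ⋅ Aut⁰V ⋅ Aut⁺V`, with unique factors; in particular, if `J_1(V) = 0`,
then `Aut V ≅ Aut⁺V ⋊ Aut⁰V` (unique factorization `f = h ∘ k` with `h ∈ Aut⁰V`,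
`k ∈ Aut⁺V`, and `Aut⁺V` is normal in `Aut V`). -/
theorem aut_decomposition {K V : Type*} [RCLike K]
    [AddCommGroup V] [Module K V]
    (A : VA K V) (W : VOAsCFT A) (hs : A.IsSimple) :
    (∀ f : V → V, A.IsVAAut f →
      ∃! p : (V → V) × (V → V) × (V → V),
        W.AutMinus p.1 ∧ W.AutZero p.2.1 ∧ W.AutPlus p.2.2 ∧ f = p.1 ∘ p.2.1 ∘ p.2.2) ∧
    (W.J1 = {0} →
      (∀ f : V → V, A.IsVAAut f →
        ∃! p : (V → V) × (V → V),
          W.AutZero p.1 ∧ W.AutPlus p.2 ∧ f = p.1 ∘ p.2) ∧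
      (∀ f g k : V → V, A.IsVAAut f → A.IsVAAut g →
        (∀ v, g (f v) = v) → (∀ v, f (g v) = v) →
        W.AutPlus k → W.AutPlus (f ∘ k ∘ g))) := by
  refine ⟨fun f hf => ?_, fun hJ => ?_⟩
  · obtain ⟨c, hc, h, k, hh, hk, hfhk⟩ := W.exists_decomposition hs hf
    refine ⟨(expOp (A.ncoef 1 c), h, k), ⟨W.expOp_autMinus hc, hh, hk, hfhk⟩, ?_⟩
    rintro ⟨g', h', k'⟩ ⟨hg', hh', hk', hf'⟩
    obtain ⟨rfl, rfl, rfl⟩ := W.decomposition_unique hg' hh' hk' (W.expOp_autMinus hc) hh hk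
      (hf'.symm.trans hfhk)
    rfl
  · have hdec : ∀ f : V → V, A.IsVAAut f →
        ∃ h k : V → V, W.AutZero h ∧ W.AutPlus k ∧ f = h ∘ k := by
      intro f hf
      obtain ⟨c, hc, h, k, hh, hk, hfhk⟩ := W.exists_decomposition hs hf
      rw [hJ, Set.mem_singleton_iff] at hc
      refine ⟨h, k, hh, hk, hfhk.trans (funext fun v => ?_)⟩
      exact expOp_of_eq_zero (by rw [hc, map_zero, LinearMap.zero_apply])
    refine ⟨fun f hf => ?_, fun f g k hf hg _ hfg hk => ?_⟩
    · obtain ⟨h, k, hh, hk, hfhk⟩ := hdec f hf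
      refine ⟨(h, k), ⟨hh, hk, hfhk⟩, ?_⟩
      rintro ⟨h', k'⟩ ⟨hh', hk', hf'⟩
      obtain ⟨rfl, rfl⟩ := W.comp_unique hh' hk' hh hk (hf'.symm.trans hfhk)
      rfl
    · obtain ⟨h, k₁, hh, hk₁, hfhk⟩ := hdec f hf
      exact W.autPlus_conj hg hfg hh hk₁ hfhk hk
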